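/- Let Ω ⊂ ℝⁿ be open, σ ∈ L^∞(Ω,ℝⁿ) with Div σ a Radon measure on Ω satisfying Div σ ≤ 0, and let u ∈ BV_loc(Ω) ∩ L^∞_loc(Ω). Let (v_ℓ) ⊂ W^{1,1}_loc(Ω) ∩ L^∞_loc(Ω) satisfy v_1 ≥ v_ℓ ≥ u a.e. on Ω and v_ℓ* → u⁺ H^{n-1}-a.e. on Ω. Then for every φ ∈ C_c^∞(Ω): ⟨σ, Du⁺⟩(φ) = lim_{ℓ→∞} ∫_Ω φ σ · Dv_ℓ dx. -/

import Mathlib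

open MeasureTheory Set Filter Topology Metric
open scoped RealInnerProductSpace ENNReal

noncomputable section

/-- Euclidean space `ℝⁿ`. -/
abbrev Eu (n : ℕ) : Type := EuclideanSpace ℝ (Fin n)

/-- `(n-1)`-dimensional Hausdorff measure on `ℝⁿ`. -/
def hm (n : ℕ) : Measure (Eu n) := μH[(n : ℝ) - 1]

/-- Smooth test functions compactly supported in `Ω`. -/
def IsTest {n : ℕ} (Ω : Set (Eu n)) (φ : Eu n → ℝ) : Prop :=
  ContDiff ℝ (⊤ : ℕ∞) φ ∧ HasCompactSupport φ ∧ tsupport φ ⊆ Ω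

/-- `σ ∈ L^∞(Ω, ℝⁿ)` with `‖σ‖ ≤ C` a.e. on `Ω`. -/
def Bdd {n : ℕ} (Ω : Set (Eu n)) (σ : Eu n → Eu n) (C : ℝ) : Prop :=
  AEStronglyMeasurable σ (volume.restrict Ω) ∧ ∀ᵐ x ∂(volume.restrict Ω), ‖σ x‖ ≤ C

/-- `σ ∈ L^∞_loc(Ω, ℝⁿ)`. -/
def LocBdd {n : ℕ} (Ω : Set (Eu n)) (σ : Eu n → Eu n) : Prop :=
  AEStronglyMeasurable σ (volume.restrict Ω) ∧
  ∀ K : Set (Eu n), K ⊆ Ω → IsCompact K → ∃ C : ℝ, ∀ᵐ x ∂(volume.restrict K), ‖σ x‖ ≤ C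

/-- scalar `u ∈ L^∞_loc(Ω)`. -/
def LocBddFun {n : ℕ} (Ω : Set (Eu n)) (u : Eu n → ℝ) : Prop :=
  AEStronglyMeasurable u (volume.restrict Ω) ∧
  ∀ K : Set (Eu n), K ⊆ Ω → IsCompact K → ∃ C : ℝ, ∀ᵐ x ∂(volume.restrict K), |u x| ≤ C

/-- scalar `u ∈ L^∞(Ω)` with bound `C`. -/
def BddFun {n : ℕ} (Ω : Set (Eu n)) (u : Eu n → ℝ) (C : ℝ) : Prop :=
  AEStronglyMeasurable u (volume.restrict Ω) ∧ ∀ᵐ x ∂(volume.restrict Ω), |u x| ≤ C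

/-- A measure carried by `Ω` which is finite on compact subsets of `Ω` (Radon on `Ω`). -/
def LocFinOn {n : ℕ} (Ω : Set (Eu n)) (μ : Measure (Eu n)) : Prop :=
  (∀ K : Set (Eu n), K ⊆ Ω → IsCompact K → μ K < ⊤) ∧ μ Ωᶜ = 0

/-- A finite measure carried by `Ω`. -/
def FinOn {n : ℕ} (Ω : Set (Eu n)) (μ : Measure (Eu n)) : Prop :=
  μ univ < ⊤ ∧ μ Ωᶜ = 0

/-- The (signed) measure `μp - μn` represents `-Div σ` on `Ω`: for every test function `φ`
compactly supported in `Ω` one has `∫_Ω σ·∇φ dx = ∫ φ dμp - ∫ φ dμn`. -/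
def RepNegDiv {n : ℕ} (Ω : Set (Eu n)) (σ : Eu n → Eu n) (μp μn : Measure (Eu n)) : Prop :=
  ∀ φ : Eu n → ℝ, IsTest Ω φ →
    ∫ x in Ω, ⟪σ x, gradient φ x⟫ = (∫ x, φ x ∂μp) - ∫ x, φ x ∂μn

/-- `Div σ ≤ 0` in the sense of distributions on `Ω`. -/
def DivNonpos {n : ℕ} (Ω : Set (Eu n)) (σ : Eu n → Eu n) : Prop :=
  ∀ φ : Eu n → ℝ, IsTest Ω φ → (∀ x, 0 ≤ φ x) → 0 ≤ ∫ x in Ω, ⟪σ x, gradient φ x⟫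

/-- The set `A` has Lebesgue density zero at the point `x`. -/
def DensityZeroAt {n : ℕ} (A : Set (Eu n)) (x : Eu n) : Prop :=
  Tendsto (fun r : ℝ => volume (A ∩ ball x r) / volume (ball x r)) (𝓝[>] 0) (𝓝 0)

/-- The upper (approximate) representative `u⁺`: Lebesgue value at approximate continuity
points, larger jump value at approximate jump points. -/
def upperRep {n : ℕ} (u : Eu n → ℝ) (x : Eu n) : ℝ :=
  sInf {t : ℝ | DensityZeroAt {y | t < u y} x}

/-- The lower (approximate) representative `u⁻`. -/
def lowerRep {n : ℕ} (u : Eu n → ℝ) (x : Eu n) : ℝ :=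
  sSup {t : ℝ | DensityZeroAt {y | u y < t} x}

/-- The precise (mean-value) representative `u* = (u⁺ + u⁻)/2`. -/
def preciseRep {n : ℕ} (u : Eu n → ℝ) (x : Eu n) : ℝ := (upperRep u x + lowerRep u x) / 2

/-- `Du = θ·ν` is the gradient measure of `u` on `Ω` with total variation `ν` and
polar vector `θ` (so `ν = |Du|`). -/
def HasGradMeasure {n : ℕ} (Ω : Set (Eu n)) (u : Eu n → ℝ) (ν : Measure (Eu n))
    (θ : Eu n → Eu n) : Prop :=
  (∀ᵐ x ∂ν, ‖θ x‖ = 1) ∧ ν Ωᶜ = 0 ∧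
  ∀ φ : Eu n → ℝ, IsTest Ω φ → ∫ x in Ω, u x • gradient φ x = - ∫ x, φ x • θ x ∂ν

/-- `u ∈ BV_loc(Ω)`. -/
def MemBVLoc {n : ℕ} (Ω : Set (Eu n)) (u : Eu n → ℝ) : Prop :=
  LocallyIntegrableOn u Ω ∧
  ∃ ν θ, LocFinOn Ω ν ∧ HasGradMeasure Ω u ν θ

/-- `g` is the weak (Sobolev) gradient of `u ∈ W^{1,1}(Ω)`. -/
def HasSobGrad {n : ℕ} (Ω : Set (Eu n)) (u : Eu n → ℝ) (g : Eu n → Eu n) : Prop :=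
  IntegrableOn g Ω ∧
  ∀ φ : Eu n → ℝ, IsTest Ω φ → ∫ x in Ω, u x • gradient φ x = - ∫ x in Ω, φ x • g x

/-- `u ∈ W^{1,1}(Ω)`. -/
def MemW11 {n : ℕ} (Ω : Set (Eu n)) (u : Eu n → ℝ) : Prop :=
  IntegrableOn u Ω ∧ ∃ g, HasSobGrad Ω u g

/-- `u ∈ W^{1,1}_loc(Ω)` with weak gradient `g`. -/
def HasSobGradLoc {n : ℕ} (Ω : Set (Eu n)) (u : Eu n → ℝ) (g : Eu n → Eu n) : Prop :=
  LocallyIntegrableOn g Ω ∧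
  ∀ φ : Eu n → ℝ, IsTest Ω φ → ∫ x in Ω, u x • gradient φ x = - ∫ x in Ω, φ x • g x

def MemW11Loc {n : ℕ} (Ω : Set (Eu n)) (u : Eu n → ℝ) : Prop :=
  LocallyIntegrableOn u Ω ∧ ∃ g, HasSobGradLoc Ω u g

/-- `T` is the interior trace of `u` on `∂Ω`, characterized `H^{n-1}`-a.e. on `∂Ω`
by convergence of interior mean values. -/
def IsIntTrace {n : ℕ} (Ω : Set (Eu n)) (u T : Eu n → ℝ) : Prop :=
  ∀ᵐ x ∂((hm n).restrict (frontier Ω)),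
    Tendsto (fun r : ℝ => (∫ y in Ω ∩ ball x r, |u y - T x|) / (volume (ball x r)).toReal)
      (𝓝[>] 0) (𝓝 0)

/-- The domain assumption `H^{n-1}(∂Ω) = P(Ω) < ∞`, in the equivalent form
`𝟙_Ω ∈ BV(ℝⁿ)` with `|D𝟙_Ω| = H^{n-1}⌞∂Ω`. -/
def DomainAssum {n : ℕ} (Ω : Set (Eu n)) : Prop :=
  hm n (frontier Ω) < ⊤ ∧
  ∃ θ, HasGradMeasure (univ : Set (Eu n)) (Ω.indicator fun _ => (1 : ℝ))
    ((hm n).restrict (frontier Ω)) θ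

/-- `g` is the normal trace `σ_n*` of `σ` on `∂Ω`, characterized by the Gauss–Green
formula for `W^{1,1} ∩ L^∞` functions; here `μ = -Div σ ≥ 0`. -/
def IsNormalTrace {n : ℕ} (Ω : Set (Eu n)) (σ : Eu n → Eu n) (μ : Measure (Eu n))
    (g : Eu n → ℝ) : Prop :=
  ∀ (v : Eu n → ℝ) (gv : Eu n → Eu n) (T : Eu n → ℝ),
    MemW11 Ω v → (∃ C, BddFun Ω v C) → HasSobGrad Ω v gv → IsIntTrace Ω v T →
    ∀ φ : Eu n → ℝ, IsTest (univ : Set (Eu n)) φ →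
      (- ∫ x in Ω, v x * ⟪σ x, gradient φ x⟫) + (∫ x, φ x * preciseRep v x ∂μ)
        = (∫ x in Ω, φ x * ⟪σ x, gv x⟫) + ∫ x in frontier Ω, φ x * T x * g x ∂(hm n)

/-- Weakly super-1-harmonic: there is `σ ∈ L^∞` with `|σ| ≤ 1` a.e., `Div σ ≤ 0`,
and `⟨σ, Du⁺⟩ = |Du|` as measures on `Ω`. -/
def SuperOneHarmonic {n : ℕ} (Ω : Set (Eu n)) (u : Eu n → ℝ) : Prop :=
  MemBVLoc Ω u ∧ LocBddFun Ω u ∧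
  ∃ σ : Eu n → Eu n, ∃ μ : Measure (Eu n),
    Bdd Ω σ 1 ∧ DivNonpos Ω σ ∧ RepNegDiv Ω σ μ 0 ∧ LocFinOn Ω μ ∧
    ∃ ν θ, LocFinOn Ω ν ∧ HasGradMeasure Ω u ν θ ∧
      ∀ φ : Eu n → ℝ, IsTest Ω φ →
        (- ∫ x in Ω, u x * ⟪σ x, gradient φ x⟫) + (∫ x, φ x * upperRep u x ∂μ)
          = ∫ x, φ x ∂ν

/-- If the mean oscillation of `v` around the value `c` vanishes at `x`, then every set on which
`v` stays away from `c` has density zero at `x`. -/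
lemma densityZeroAt_of_tendsto_average {n : ℕ} {v : Eu n → ℝ} {x : Eu n} {c : ℝ}
    {A : Set (Eu n)} {r₀ ε : ℝ} (hr₀ : 0 < r₀) (hv : IntegrableOn v (closedBall x r₀))
    (h : Tendsto (fun r => ⨍ y in closedBall x r, |v y - c|) (𝓝[>] 0) (𝓝 0))
    (hε : 0 < ε) (hA : ∀ y ∈ A, ε ≤ |v y - c|) : DensityZeroAt A x := by
  have hlim : Tendsto (fun r => ENNReal.ofReal ((⨍ y in closedBall x r, |v y - c|) / ε))
      (𝓝[>] 0) (𝓝 0) := by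
    have := ENNReal.tendsto_ofReal (h.div_const ε)
    simpa using this
  refine tendsto_of_tendsto_of_tendsto_of_le_of_le' tendsto_const_nhds hlim
    (Eventually.of_forall fun _ => zero_le) ?_
  have hr : ∀ᶠ r in 𝓝[>] (0 : ℝ), r ∈ Ioo 0 r₀ := Ioo_mem_nhdsGT hr₀
  filter_upwards [hr] with r hr
  have hsub : closedBall x r ⊆ closedBall x r₀ := closedBall_subset_closedBall hr.2.le
  have hint : IntegrableOn (fun y => v y - c) (closedBall x r) :=
    (hv.mono_set hsub).sub (integrableOn_const (isCompact_closedBall x r).measure_lt_top.ne)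
  have hvol : volume (ball x r) = volume (closedBall x r) := by
    rw [Measure.addHaar_closedBall _ _ hr.1.le, Measure.addHaar_ball_of_pos _ _ hr.1]
  have hpos : 0 < volume (closedBall x r) := measure_closedBall_pos _ _ hr.1
  have htop : volume (closedBall x r) ≠ ⊤ := (isCompact_closedBall x r).measure_lt_top.ne
  have h1 : volume (A ∩ ball x r) ≤
      (∫⁻ y in closedBall x r, ‖v y - c‖ₑ) / ENNReal.ofReal ε := by
    calc volume (A ∩ ball x r)
        ≤ volume (A ∩ closedBall x r) :=
          measure_mono (inter_subset_inter_right _ ball_subset_closedBall)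
      _ = (volume.restrict (closedBall x r)) A :=
          (Measure.restrict_apply' measurableSet_closedBall).symm
      _ ≤ (volume.restrict (closedBall x r)) {y | ENNReal.ofReal ε ≤ ‖v y - c‖ₑ} := by
          refine measure_mono fun y hy => ?_
          rw [mem_ofPred_eq, ← ofReal_norm]
          exact ENNReal.ofReal_le_ofReal (hA y hy)
      _ ≤ _ := meas_ge_le_lintegral_div hint.aestronglyMeasurable.enorm
          (by simpa using hε) ENNReal.ofReal_ne_top
  rw [hvol]
  refine (ENNReal.div_le_div_right h1 _).trans (le_of_eq ?_)
  rw [← ofReal_integral_norm_eq_lintegral_enorm hint, setAverage_eq, smul_eq_mul,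
    Measure.real, ENNReal.ofReal_div_of_pos hε, ENNReal.ofReal_mul (by positivity),
    ENNReal.ofReal_inv_of_pos (ENNReal.toReal_pos hpos.ne' htop), ENNReal.ofReal_toReal htop]
  simp only [div_eq_mul_inv, Real.norm_eq_abs]
  ring

lemma upperRep_eq_of_tendsto_average {n : ℕ} {v : Eu n → ℝ} {x : Eu n} {c r₀ : ℝ}
    (hr₀ : 0 < r₀) (hv : IntegrableOn v (closedBall x r₀))
    (h : Tendsto (fun r => ⨍ y in closedBall x r, |v y - c|) (𝓝[>] 0) (𝓝 0)) :
    upperRep v x = c := by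
  have hsup : Ioi c ⊆ {t : ℝ | DensityZeroAt {y | t < v y} x} := fun t ht =>
    densityZeroAt_of_tendsto_average hr₀ hv h (sub_pos.2 ht) fun y hy => by
      have : t < v y := hy
      exact (sub_le_sub_right this.le c).trans (le_abs_self _)
  have hsub : {t : ℝ | DensityZeroAt {y | t < v y} x} ⊆ Ici c := by
    intro t ht
    by_contra hlt
    have hlt : t < c := not_le.1 hlt
    have h2 : DensityZeroAt {y | t < v y}ᶜ x :=
      densityZeroAt_of_tendsto_average hr₀ hv h (sub_pos.2 hlt) fun y hy => by
        have : v y ≤ t := not_lt.1 hy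
        rw [abs_sub_comm]
        exact (sub_le_sub_left this c).trans (le_abs_self _)
    have h3 := Tendsto.add ht h2
    rw [add_zero] at h3
    refine absurd (ge_of_tendsto h3 (?_ : ∀ᶠ r in 𝓝[>] (0 : ℝ), (1 : ℝ≥0∞) ≤ _)) (by simp)
    filter_upwards [self_mem_nhdsWithin] with r hr
    have hpos : 0 < volume (ball x r) := measure_ball_pos _ _ hr
    rw [← ENNReal.add_div, ENNReal.le_div_iff_mul_le (Or.inl hpos.ne')
      (Or.inl measure_ball_lt_top.ne), one_mul]
    refine le_trans (measure_mono ?_) (measure_union_le _ _)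
    intro y hy
    by_cases h : t < v y
    · exact Or.inl ⟨h, hy⟩
    · exact Or.inr ⟨h, hy⟩
  refine le_antisymm (le_of_forall_gt fun t ht => ?_) (le_csInf ⟨c + 1, hsup (by simp)⟩ hsub)
  obtain ⟨s, hs, hst⟩ := exists_between ht
  exact (csInf_le ⟨c, hsub⟩ (hsup hs)).trans_lt hst

lemma preciseRep_eq_of_tendsto_average {n : ℕ} {v : Eu n → ℝ} {x : Eu n} {c r₀ : ℝ}
    (hr₀ : 0 < r₀) (hv : IntegrableOn v (closedBall x r₀))
    (h : Tendsto (fun r => ⨍ y in closedBall x r, |v y - c|) (𝓝[>] 0) (𝓝 0)) :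
    preciseRep v x = c := by
  have hneg : upperRep (fun y => -v y) x = -c :=
    upperRep_eq_of_tendsto_average hr₀ hv.neg (by
      simpa only [← neg_sub', abs_neg] using h)
  have hlow : lowerRep v x = c := by
    have : {t : ℝ | DensityZeroAt {y | v y < t} x} =
        -{t : ℝ | DensityZeroAt {y | t < -v y} x} := by
      ext t
      simp only [mem_ofPred_eq, Set.mem_neg, neg_lt_neg_iff]
    rw [lowerRep, this, Real.sSup_neg]
    exact neg_eq_iff_eq_neg.2 hneg
  rw [preciseRep, upperRep_eq_of_tendsto_average hr₀ hv h, hlow]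
  ring

/-- A measure with `(n-1)`-growth on balls centred in `K` does not charge the `H^{n-1}`-null
subsets of `K`. -/
lemma measure_inter_eq_zero_of_hm_eq_zero {n : ℕ} {ν : Measure (Eu n)} {K : Set (Eu n)}
    (hK : MeasurableSet K) {ε : ℝ} (hε : 0 < ε) {M : ℝ} (hM : 0 < M)
    (h : ∀ x ∈ K, ∀ ρ ∈ Ioo 0 ε,
      ν (closedBall x ρ) ≤ ENNReal.ofReal M * ENNReal.ofReal ρ ^ ((n : ℝ) - 1))
    {s : Set (Eu n)} (hs : hm n s = 0) : ν (s ∩ K) = 0 := by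
  have hM0 : ENNReal.ofReal M ≠ 0 := by simpa using hM
  have key : (ENNReal.ofReal M)⁻¹ • ν.restrict K ≤ hm n := by
    refine Measure.le_hausdorffMeasure _ _ (ENNReal.ofReal (ε / 2)) (by simpa using hε)
      fun t ht => ?_
    rw [Measure.smul_apply, smul_eq_mul, Measure.restrict_apply' hK,
      ENNReal.inv_mul_le_iff hM0 ENNReal.ofReal_ne_top]
    rcases (t ∩ K).eq_empty_or_nonempty with he | ⟨x, hxt, hxK⟩
    · simp [he]
    have hfin : ediam t ≠ ⊤ := (ht.trans_lt ENNReal.ofReal_lt_top).ne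
    set d := (ediam t).toReal with hd
    have hdε : d ≤ ε / 2 := ENNReal.toReal_le_of_le_ofReal (by positivity) ht
    have hdt : ediam t = ENNReal.ofReal d := (ENNReal.ofReal_toReal hfin).symm
    have hd0 : 0 ≤ d := ENNReal.toReal_nonneg
    rw [hdt]
    have hcont : Tendsto (fun ρ : ℝ => ENNReal.ofReal M * ENNReal.ofReal ρ ^ ((n : ℝ) - 1))
        (𝓝[>] d) (𝓝 (ENNReal.ofReal M * ENNReal.ofReal d ^ ((n : ℝ) - 1))) := by
      refine ENNReal.Tendsto.const_mul ?_ (Or.inr ENNReal.ofReal_ne_top)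
      exact ((ENNReal.continuous_rpow_const.comp ENNReal.continuous_ofReal).tendsto d).mono_left
        nhdsWithin_le_nhds
    refine ge_of_tendsto hcont ?_
    filter_upwards [Ioo_mem_nhdsGT (show d < ε by linarith)] with ρ hρ
    refine (measure_mono ?_).trans (h x hxK ρ ⟨hd0.trans_lt hρ.1, hρ.2⟩)
    intro y hy
    have h1 : edist y x ≤ ENNReal.ofReal d := hdt ▸ Metric.edist_le_ediam_of_mem hy.1 hxt
    rw [edist_dist] at h1
    exact ((ENNReal.ofReal_le_ofReal_iff hd0).1 h1).trans hρ.1.le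
  have := key s
  rw [hs, Measure.smul_apply, smul_eq_mul, Measure.restrict_apply' hK] at this
  simpa using this

/-- A smooth radial cutoff, equal to `1` on `closedBall x r` and to `0` off `ball x R`. -/
def radialCutoff {n : ℕ} (x : Eu n) (r R : ℝ) (y : Eu n) : ℝ :=
  Real.smoothTransition ((R ^ 2 - ‖y - x‖ ^ 2) / (R ^ 2 - r ^ 2))

lemma contDiff_radialCutoff {n : ℕ} (x : Eu n) (r R : ℝ) :
    ContDiff ℝ (⊤ : ℕ∞) (radialCutoff x r R) := by
  refine Real.smoothTransition.contDiff.comp ?_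
  exact (contDiff_const.sub ((contDiff_id.sub contDiff_const).norm_sq ℝ)).div_const _

lemma radialCutoff_nonneg {n : ℕ} (x : Eu n) (r R : ℝ) (y : Eu n) : 0 ≤ radialCutoff x r R y :=
  Real.smoothTransition.nonneg _

lemma radialCutoff_le_one {n : ℕ} (x : Eu n) (r R : ℝ) (y : Eu n) : radialCutoff x r R y ≤ 1 :=
  Real.smoothTransition.le_one _

lemma radialCutoff_eq_one {n : ℕ} {x : Eu n} {r R : ℝ} (hr : 0 < r) (hR : r < R) {y : Eu n}
    (hy : y ∈ closedBall x r) : radialCutoff x r R y = 1 := by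
  refine Real.smoothTransition.one_of_one_le ?_
  have h1 : ‖y - x‖ ≤ r := by simpa [dist_eq_norm] using hy
  have h2 : ‖y - x‖ ^ 2 ≤ r ^ 2 := by gcongr
  rw [one_le_div (by nlinarith)]
  linarith

lemma radialCutoff_eq_zero {n : ℕ} {x : Eu n} {r R : ℝ} (hr : 0 < r) (hR : r < R) {y : Eu n}
    (hy : y ∉ ball x R) : radialCutoff x r R y = 0 := by
  refine Real.smoothTransition.zero_of_nonpos ?_
  have h1 : R ≤ ‖y - x‖ := by simpa [dist_eq_norm] using hy
  have h2 : R ^ 2 ≤ ‖y - x‖ ^ 2 := pow_le_pow_left₀ (hr.trans hR).le h1 2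
  exact div_nonpos_of_nonpos_of_nonneg (by linarith) (by nlinarith)

lemma tsupport_radialCutoff_subset {n : ℕ} {x : Eu n} {r R : ℝ} (hr : 0 < r) (hR : r < R) :
    tsupport (radialCutoff x r R) ⊆ closedBall x R :=
  closure_minimal (fun y hy => by
    by_contra h
    exact hy (radialCutoff_eq_zero hr hR fun h' => h (ball_subset_closedBall h')))
    isClosed_closedBall

lemma hasCompactSupport_radialCutoff {n : ℕ} {x : Eu n} {r R : ℝ} (hr : 0 < r) (hR : r < R) :
    HasCompactSupport (radialCutoff x r R) :=
  (isCompact_closedBall x R).of_isClosed_subset (isClosed_tsupport _)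
    (tsupport_radialCutoff_subset hr hR)

/-- The derivative of the radial cutoff is controlled by its radial part. -/
lemma norm_fderiv_radialCutoff_le {n : ℕ} {x : Eu n} {r R : ℝ} (hr : 0 < r) (hR : r < R)
    (y : Eu n) :
    r * ‖fderiv ℝ (radialCutoff x r R) y‖ ≤ -fderiv ℝ (radialCutoff x r R) y (y - x) := by
  rcases lt_or_ge ‖y - x‖ r with hy | hy
  · have : radialCutoff x r R =ᶠ[𝓝 y] fun _ => (1 : ℝ) := by
      filter_upwards [isOpen_ball.mem_nhds (show y ∈ ball x r by simpa [dist_eq_norm] using hy)]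
        with z hz using radialCutoff_eq_one hr hR (ball_subset_closedBall hz)
    rw [this.fderiv_eq]
    simp
  set a := (R ^ 2 - ‖y - x‖ ^ 2) / (R ^ 2 - r ^ 2) with ha
  have hD : 0 < R ^ 2 - r ^ 2 := by nlinarith
  have hs : HasDerivAt Real.smoothTransition (deriv Real.smoothTransition a) a :=
    ((Real.smoothTransition.contDiff (n := 1)).differentiable
      (by simp)).differentiableAt.hasDerivAt
  have hs0 : 0 ≤ deriv Real.smoothTransition a := Real.smoothTransition.monotone.deriv_nonneg
  have h1 : HasFDerivAt (fun z : Eu n => ‖z - x‖ ^ 2) (2 • innerSL ℝ (y - x)) y := by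
    simpa using ((hasFDerivAt_id y).sub_const x).norm_sq
  have h2 := ((h1.const_sub (R ^ 2)).mul_const (R ^ 2 - r ^ 2)⁻¹)
  have h3 : HasFDerivAt (radialCutoff x r R) _ y := hs.comp_hasFDerivAt y h2
  rw [h3.fderiv]
  have hk : deriv Real.smoothTransition a • (R ^ 2 - r ^ 2)⁻¹ • -(2 • innerSL ℝ (y - x)) =
      (-(2 * deriv Real.smoothTransition a * (R ^ 2 - r ^ 2)⁻¹)) • innerSL ℝ (y - x) := by
    module
  rw [hk, norm_smul, innerSL_apply_norm, norm_neg, Real.norm_of_nonneg (by positivity)]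
  simp only [_root_.smul_apply, innerSL_apply_apply, real_inner_self_eq_norm_sq,
    smul_eq_mul]
  have : r * ‖y - x‖ ≤ ‖y - x‖ ^ 2 := by nlinarith [norm_nonneg (y - x)]
  have hpos : 0 ≤ 2 * deriv Real.smoothTransition a * (R ^ 2 - r ^ 2)⁻¹ := by positivity
  nlinarith [mul_le_mul_of_nonneg_left this hpos]

/-- The divergence theorem for the field `y ↦ p y • (y - x)`. -/
lemma integral_fderiv_apply_sub {n : ℕ} {p : Eu n → ℝ} (hp : ContDiff ℝ 1 p)
    (hc : HasCompactSupport p) (x : Eu n) :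
    ∫ y, fderiv ℝ p y (y - x) = -(n * ∫ y, p y) := by
  let b := EuclideanSpace.basisFun (Fin n) ℝ
  have hfc : Continuous (fderiv ℝ p) := hp.continuous_fderiv (by simp)
  have hint : ∀ j, Integrable fun y => inner ℝ (b j) (y - x) * fderiv ℝ p y (b j) := fun j =>
    Continuous.integrable_of_hasCompactSupport (by fun_prop) ((hc.fderiv_apply ℝ (b j)).mul_left)
  have hj : ∀ j, ∫ y, inner ℝ (b j) (y - x) * fderiv ℝ p y (b j) = -∫ y, p y := by
    intro j
    have hd : ∀ y, HasFDerivAt (fun y => inner ℝ (b j) (y - x)) (innerSL ℝ (b j)) y := fun y =>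
      (innerSL ℝ (b j)).hasFDerivAt.comp y ((hasFDerivAt_id y).sub_const x)
    have hone : ∀ y, fderiv ℝ (fun y => inner ℝ (b j) (y - x)) y (b j) * p y = p y := fun y => by
      rw [(hd y).fderiv]
      simp [b]
    have hpint : Integrable p := hp.continuous.integrable_of_hasCompactSupport hc
    rw [integral_mul_fderiv_eq_neg_fderiv_mul_of_integrable _ (hint j) _
      (fun y _ => (hd y).differentiableAt) fun y _ => hp.differentiable (by simp) y]
    · simp only [hone]
    · simpa only [hone] using hpint
    · exact Continuous.integrable_of_hasCompactSupport (by fun_prop) hc.mul_left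
  have hsum : ∀ y, fderiv ℝ p y (y - x) =
      ∑ j, inner ℝ (b j) (y - x) * fderiv ℝ p y (b j) := fun y => by
    conv_lhs => rw [← b.sum_repr' (y - x)]
    simp only [map_sum, map_smul, smul_eq_mul]
  simp only [hsum]
  rw [integral_finsetSum _ fun j _ => hint j]
  simp [hj]

/-- Trace inequality: an integral against the gradient of the radial cutoff is controlled
by integrals over the ball, uniformly in the thickness of the shell. -/
lemma integral_mul_norm_fderiv_radialCutoff_le {n : ℕ} {x : Eu n} {r R : ℝ} (hr : 0 < r)
    (hR : r < R) {q : Eu n → ℝ} (hq : ContDiff ℝ 1 q) (hq0 : ∀ y, 0 ≤ q y) :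
    r * ∫ y, q y * ‖fderiv ℝ (radialCutoff x r R) y‖ ≤
      n * (∫ y in closedBall x R, q y) + R * ∫ y in closedBall x R, ‖fderiv ℝ q y‖ := by
  set ζ := radialCutoff x r R with hζ
  have hζc : ContDiff ℝ 1 ζ := (contDiff_radialCutoff x r R).of_le (by exact_mod_cast le_top)
  have hζs : HasCompactSupport ζ := hasCompactSupport_radialCutoff hr hR
  have hfζ : Continuous (fderiv ℝ ζ) := hζc.continuous_fderiv (by simp)
  have hfq : Continuous (fderiv ℝ q) := hq.continuous_fderiv (by simp)
  have hqc := hq.continuous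
  have hζcont := hζc.continuous
  have hz : ∀ y ∉ closedBall x R, ζ y = 0 := fun y hy =>
    radialCutoff_eq_zero hr hR fun h => hy (ball_subset_closedBall h)
  have hprod : ∀ y, fderiv ℝ (fun y => q y * ζ y) y (y - x) =
      q y * fderiv ℝ ζ y (y - x) + ζ y * fderiv ℝ q y (y - x) := fun y => by
    rw [fderiv_fun_mul (hq.differentiable (by simp) y) (hζc.differentiable (by simp) y)]
    simp
  have hsζ : HasCompactSupport fun y => fderiv ℝ ζ y (y - x) := by
    refine (hζs.fderiv ℝ).mono' fun y hy => ?_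
    refine subset_tsupport _ fun h => hy ?_
    simp [h]
  have hI1 : Integrable fun y => q y * fderiv ℝ ζ y (y - x) :=
    Continuous.integrable_of_hasCompactSupport (by fun_prop) hsζ.mul_left
  have hI2 : Integrable fun y => ζ y * fderiv ℝ q y (y - x) :=
    Continuous.integrable_of_hasCompactSupport (by fun_prop) hζs.mul_right
  have hI3 : Integrable fun y => q y * ‖fderiv ℝ ζ y‖ :=
    Continuous.integrable_of_hasCompactSupport (by fun_prop) (hζs.fderiv ℝ).norm.mul_left
  have hdiv := integral_fderiv_apply_sub (hq.mul hζc) hζs.mul_left x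
  simp only [hprod] at hdiv
  rw [integral_add hI1 hI2] at hdiv
  have h1 : r * ∫ y, q y * ‖fderiv ℝ ζ y‖ ≤ -∫ y, q y * fderiv ℝ ζ y (y - x) := by
    rw [← integral_const_mul, ← integral_neg]
    refine integral_mono (hI3.const_mul r) hI1.neg fun y => ?_
    have := mul_le_mul_of_nonneg_left (norm_fderiv_radialCutoff_le (x := x) hr hR y) (hq0 y)
    dsimp only
    linarith
  have hK := isCompact_closedBall x R
  have h2 : ∫ y, q y * ζ y ≤ ∫ y in closedBall x R, q y := by
    rw [← setIntegral_eq_integral_of_forall_compl_eq_zero (s := closedBall x R)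
      fun y hy => by rw [hz y hy, mul_zero]]
    refine setIntegral_mono
      ((by fun_prop : Continuous fun y => q y * ζ y).continuousOn.integrableOn_compact hK)
      (hqc.continuousOn.integrableOn_compact hK) fun y => ?_
    exact mul_le_of_le_one_right (hq0 y) (radialCutoff_le_one _ _ _ _)
  have h3 : ∫ y, ζ y * fderiv ℝ q y (y - x) ≤ R * ∫ y in closedBall x R, ‖fderiv ℝ q y‖ := by
    rw [← setIntegral_eq_integral_of_forall_compl_eq_zero (s := closedBall x R)
      fun y hy => by rw [hz y hy, zero_mul], ← integral_const_mul]
    refine setIntegral_mono_on hI2.integrableOn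
      ((by fun_prop : Continuous fun y => R * ‖fderiv ℝ q y‖).continuousOn.integrableOn_compact hK)
      measurableSet_closedBall fun y hy => ?_
    have hy' : ‖y - x‖ ≤ R := by simpa [dist_eq_norm] using hy
    calc ζ y * fderiv ℝ q y (y - x) ≤ ζ y * (‖fderiv ℝ q y‖ * ‖y - x‖) := by
          gcongr
          · exact radialCutoff_nonneg _ _ _ _
          · exact (le_abs_self _).trans ((fderiv ℝ q y).le_opNorm _)
      _ ≤ 1 * (‖fderiv ℝ q y‖ * R) := by
          gcongr
          exact radialCutoff_le_one _ _ _ _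
      _ = _ := by ring
  have hn : (n : ℝ) * ∫ y, q y * ζ y ≤ n * ∫ y in closedBall x R, q y := by gcongr
  linarith

lemma lintegral_comp_add_smul_le {n : ℕ} {F : Eu n → ℝ≥0∞} (hF : Measurable F) (a : Eu n) {t : ℝ}
    (ht : 1 / 2 ≤ t) : ∫⁻ z, F (a + t • z) ≤ 2 ^ n * ∫⁻ z, F z := by
  have ht0 : 0 < t := by linarith
  have h1 : ∫⁻ z, F (a + t • z) = ∫⁻ z, F (a + z) ∂(Measure.map (t • ·) volume) :=
    (lintegral_map (μ := volume) (f := fun z => F (a + z)) (g := fun z => t • z)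
      (by fun_prop) (by fun_prop)).symm
  rw [h1, Measure.map_addHaar_smul _ ht0.ne', lintegral_smul_measure,
    lintegral_add_left_eq_self, smul_eq_mul]
  gcongr
  rw [finrank_euclideanSpace_fin, abs_of_pos (by positivity), ← inv_pow]
  calc ENNReal.ofReal (t⁻¹ ^ n) ≤ ENNReal.ofReal (2 ^ n) := by
        gcongr
        exact inv_le_of_inv_le₀ (by norm_num) (by linarith)
    _ = 2 ^ n := by rw [ENNReal.ofReal_pow (by norm_num)]; norm_num

/-- Averaging `F` over the points dividing the segments with endpoints in `s` in the ratio
`t : 1 - t`. -/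
lemma lintegral_lintegral_segment_le {n : ℕ} {F : Eu n → ℝ≥0∞} (hF : Measurable F)
    (s : Set (Eu n)) {t : ℝ} :
    ∫⁻ y in s, ∫⁻ z in s, F ((1 - t) • y + t • z) ≤ 2 ^ n * volume s * ∫⁻ z, F z := by
  have key : ∀ (t : ℝ), 1 / 2 ≤ t →
      ∫⁻ y in s, ∫⁻ z in s, F ((1 - t) • y + t • z) ≤ 2 ^ n * volume s * ∫⁻ z, F z := by
    intro t ht
    calc ∫⁻ y in s, ∫⁻ z in s, F ((1 - t) • y + t • z)
        ≤ ∫⁻ y in s, 2 ^ n * ∫⁻ z, F z :=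
          lintegral_mono fun y => (setLIntegral_le_lintegral _ _).trans
            (lintegral_comp_add_smul_le hF _ ht)
      _ = 2 ^ n * volume s * ∫⁻ z, F z := by
          rw [setLIntegral_const]
          ring
  rcases le_total (1 / 2) t with ht | ht
  · exact key t ht
  · rw [lintegral_lintegral_swap (by fun_prop)]
    have := key (1 - t) (by linarith)
    simpa only [sub_sub_cancel, add_comm] using this

lemma enorm_sub_le_lintegral_segment {n : ℕ} {h : Eu n → ℝ} (hh : ContDiff ℝ 1 h) (y z : Eu n) :
    ‖h z - h y‖ₑ ≤ ‖z - y‖ₑ *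
      ∫⁻ t in Ioc (0 : ℝ) 1, ‖fderiv ℝ h ((1 - t) • y + t • z)‖ₑ := by
  have hfc : Continuous (fderiv ℝ h) := hh.continuous_fderiv (by simp)
  have hd : ∀ t ∈ uIcc (0 : ℝ) 1, HasDerivAt (fun t : ℝ => h ((1 - t) • y + t • z))
      (fderiv ℝ h ((1 - t) • y + t • z) (z - y)) t := by
    intro t _
    have h1 : HasDerivAt (fun t : ℝ => (1 - t) • y + t • z) (z - y) t := by
      have := (((hasDerivAt_id t).const_sub 1).smul_const y).add ((hasDerivAt_id t).smul_const z)
      convert! this using 1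
      module
    exact ((hh.differentiable (by simp) _).hasFDerivAt).comp_hasDerivAt t h1
  have hft := intervalIntegral.integral_eq_sub_of_hasDerivAt hd
    (Continuous.intervalIntegrable (by fun_prop) _ _)
  simp only [sub_self, zero_smul, one_smul, zero_add, sub_zero, add_zero] at hft
  rw [← hft, intervalIntegral.integral_of_le zero_le_one]
  refine (enorm_integral_le_lintegral_enorm _).trans ?_
  rw [← lintegral_const_mul _ (by fun_prop)]
  refine lintegral_mono fun t => ?_
  rw [mul_comm]
  exact (fderiv ℝ h _).le_opENorm _

/-- **Poincaré inequality** on a ball, in `L¹`. -/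
lemma integral_abs_sub_average_le {n : ℕ} {h : Eu n → ℝ} (hh : ContDiff ℝ 1 h) (x : Eu n) {R : ℝ}
    (hR : 0 < R) :
    ∫ y in closedBall x R, |h y - ⨍ z in closedBall x R, h z| ≤
      2 ^ (n + 1) * R * ∫ y in closedBall x R, ‖fderiv ℝ h y‖ := by
  set B := closedBall x R with hB
  have hfc : Continuous (fderiv ℝ h) := hh.continuous_fderiv (by simp)
  have hhc := hh.continuous
  have hK : IsCompact B := isCompact_closedBall x R
  have hBm : MeasurableSet B := measurableSet_closedBall
  have hBpos : 0 < volume B := measure_closedBall_pos _ _ hR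
  have hBtop : volume B ≠ ⊤ := hK.measure_lt_top.ne
  have hBr : 0 < volume.real B := ENNReal.toReal_pos hBpos.ne' hBtop
  have hhi : IntegrableOn h B := hhc.continuousOn.integrableOn_compact hK
  set F : Eu n → ℝ≥0∞ := B.indicator fun z => ‖fderiv ℝ h z‖ₑ with hF
  have hFm : Measurable F := (by fun_prop : Measurable fun z => ‖fderiv ℝ h z‖ₑ).indicator hBm
  have hdouble : ∫⁻ y in B, ∫⁻ z in B, ‖h z - h y‖ₑ ≤
      ENNReal.ofReal (2 * R) * (2 ^ n * volume B * ∫⁻ z, F z) := by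
    calc ∫⁻ y in B, ∫⁻ z in B, ‖h z - h y‖ₑ
        ≤ ∫⁻ y in B, ∫⁻ z in B, ENNReal.ofReal (2 * R) *
            ∫⁻ t in Ioc (0 : ℝ) 1, F ((1 - t) • y + t • z) := by
          refine setLIntegral_mono' hBm fun y hy => setLIntegral_mono' hBm fun z hz => ?_
          refine (enorm_sub_le_lintegral_segment hh y z).trans ?_
          gcongr ?_ * ?_
          · rw [← ofReal_norm, ← dist_eq_norm]
            refine ENNReal.ofReal_le_ofReal ?_
            have h1 : dist z x ≤ R := hz
            have h2 : dist y x ≤ R := hy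
            linarith [dist_triangle_right z y x]
          · refine setLIntegral_mono' measurableSet_Ioc fun t ht => ?_
            have hmem : (1 - t) • y + t • z ∈ B :=
              convex_closedBall x R hy hz (by linarith [ht.2]) ht.1.le (by ring)
            rw [hF, indicator_of_mem hmem]
      _ = ENNReal.ofReal (2 * R) * ∫⁻ y in B, ∫⁻ z in B,
            ∫⁻ t in Ioc (0 : ℝ) 1, F ((1 - t) • y + t • z) := by
          rw [← lintegral_const_mul' _ _ ENNReal.ofReal_ne_top]
          refine lintegral_congr fun y => ?_
          rw [← lintegral_const_mul' _ _ ENNReal.ofReal_ne_top]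
      _ = ENNReal.ofReal (2 * R) * ∫⁻ t in Ioc (0 : ℝ) 1, ∫⁻ y in B, ∫⁻ z in B,
            F ((1 - t) • y + t • z) := by
          congr 1
          rw [lintegral_lintegral_swap (f := fun (t : ℝ) y => ∫⁻ z in B, F ((1 - t) • y + t • z))]
          · refine lintegral_congr fun y => ?_
            rw [lintegral_lintegral_swap (by fun_prop)]
          · exact (Measurable.lintegral_prod_right'
              (f := fun p : (ℝ × Eu n) × Eu n => F ((1 - p.1.1) • p.1.2 + p.1.1 • p.2))
              (by fun_prop)).aemeasurable
      _ ≤ ENNReal.ofReal (2 * R) * ∫⁻ t in Ioc (0 : ℝ) 1, 2 ^ n * volume B * ∫⁻ z, F z := by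
          gcongr with t
          exact lintegral_lintegral_segment_le hFm B
      _ = _ := by simp
  have hpt : ∀ y, ‖h y - ⨍ z in B, h z‖ₑ ≤ (volume B)⁻¹ * ∫⁻ z in B, ‖h z - h y‖ₑ := by
    intro y
    have h1 : h y - ⨍ z in B, h z = (volume.real B)⁻¹ * ∫ z in B, (h y - h z) := by
      have hconst : IntegrableOn (fun _ : Eu n => h y) B := integrableOn_const hBtop
      rw [integral_sub hconst hhi, setAverage_eq, setIntegral_const]
      simp only [smul_eq_mul]
      field_simp
    rw [h1, enorm_mul, Real.enorm_of_nonneg (by positivity), ENNReal.ofReal_inv_of_pos hBr,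
      Measure.real, ENNReal.ofReal_toReal hBtop]
    gcongr
    refine (enorm_integral_le_lintegral_enorm _).trans (le_of_eq ?_)
    exact lintegral_congr fun z => by rw [enorm_sub_rev]
  have hint : IntegrableOn (fun y => h y - ⨍ z in B, h z) B :=
    hhi.sub (integrableOn_const hBtop)
  have hfint : IntegrableOn (fun y => fderiv ℝ h y) B := hfc.continuousOn.integrableOn_compact hK
  have hfinal : ∫⁻ y in B, ‖h y - ⨍ z in B, h z‖ₑ ≤
      ENNReal.ofReal (2 ^ (n + 1) * R) * ∫⁻ y in B, ‖fderiv ℝ h y‖ₑ := by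
    calc ∫⁻ y in B, ‖h y - ⨍ z in B, h z‖ₑ
        ≤ ∫⁻ y in B, (volume B)⁻¹ * ∫⁻ z in B, ‖h z - h y‖ₑ := lintegral_mono hpt
      _ = (volume B)⁻¹ * ∫⁻ y in B, ∫⁻ z in B, ‖h z - h y‖ₑ :=
          lintegral_const_mul' _ _ (ENNReal.inv_ne_top.2 hBpos.ne')
      _ ≤ (volume B)⁻¹ * (ENNReal.ofReal (2 * R) * (2 ^ n * volume B * ∫⁻ z, F z)) := by
          gcongr
      _ = ((volume B)⁻¹ * volume B) * (ENNReal.ofReal (2 * R) * 2 ^ n * ∫⁻ z, F z) := by ring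
      _ = _ := by
          rw [ENNReal.inv_mul_cancel hBpos.ne' hBtop, one_mul, hF, lintegral_indicator hBm]
          congr 1
          rw [show (2 : ℝ≥0∞) = ENNReal.ofReal 2 by norm_num, ← ENNReal.ofReal_pow (by norm_num),
            ← ENNReal.ofReal_mul (by positivity)]
          congr 1
          ring
  rw [← ofReal_integral_norm_eq_lintegral_enorm hint,
    ← ofReal_integral_norm_eq_lintegral_enorm hfint, ← ENNReal.ofReal_mul (by positivity)] at hfinal
  exact (ENNReal.ofReal_le_ofReal_iff (by positivity)).1 hfinal

/-- A smooth regularization of `|g|`. -/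
def smoothAbs {n : ℕ} (ε : ℝ) (g : Eu n → ℝ) (y : Eu n) : ℝ := √(g y ^ 2 + ε ^ 2)

lemma contDiff_smoothAbs {n : ℕ} {ε : ℝ} (hε : 0 < ε) {g : Eu n → ℝ} {k : WithTop ℕ∞}
    (hg : ContDiff ℝ k g) : ContDiff ℝ k (smoothAbs ε g) :=
  ((hg.pow 2).add contDiff_const).sqrt fun y => by positivity

lemma abs_le_smoothAbs {n : ℕ} (ε : ℝ) (g : Eu n → ℝ) (y : Eu n) : |g y| ≤ smoothAbs ε g y :=
  Real.abs_le_sqrt (by nlinarith [sq_nonneg ε])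

lemma smoothAbs_le {n : ℕ} {ε : ℝ} (hε : 0 < ε) (g : Eu n → ℝ) (y : Eu n) :
    smoothAbs ε g y ≤ |g y| + ε := by
  refine Real.sqrt_le_iff.2 ⟨by positivity, ?_⟩
  nlinarith [sq_abs (g y), abs_nonneg (g y)]

lemma le_smoothAbs {n : ℕ} (ε : ℝ) (g : Eu n → ℝ) (y : Eu n) :
    ε ≤ smoothAbs ε g y :=
  Real.le_sqrt_of_sq_le (by nlinarith [sq_nonneg (g y)])

lemma norm_fderiv_smoothAbs_le {n : ℕ} {ε : ℝ} (hε : 0 < ε) {g : Eu n → ℝ} (y : Eu n)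
    (hg : DifferentiableAt ℝ g y) : ‖fderiv ℝ (smoothAbs ε g) y‖ ≤ ‖fderiv ℝ g y‖ := by
  have hpos : 0 < smoothAbs ε g y := hε.trans_le (le_smoothAbs ε g y)
  have h1 : HasFDerivAt (smoothAbs ε g) _ y :=
    ((hg.hasFDerivAt.pow 2).add_const (ε ^ 2)).sqrt (by positivity)
  rw [h1.fderiv, norm_smul]
  have h2 : ‖1 / (2 * √(g y ^ 2 + ε ^ 2))‖ * ‖(2 * g y ^ (2 - 1)) • fderiv ℝ g y‖ =
      |g y| / smoothAbs ε g y * ‖fderiv ℝ g y‖ := by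
    rw [norm_smul, Real.norm_of_nonneg (by positivity)]
    simp only [smoothAbs, norm_mul, Real.norm_eq_abs, Nat.add_one_sub_one, pow_one, abs_two]
    field_simp
  have h3 : |g y| / smoothAbs ε g y ≤ 1 := (div_le_one hpos).2 (abs_le_smoothAbs ε g y)
  simpa using h2.le.trans (mul_le_of_le_one_left (norm_nonneg _) h3)

/-- The trace inequality combined with the Poincaré inequality. -/
lemma integral_abs_sub_average_mul_norm_fderiv_le {n : ℕ} {x : Eu n} {r R : ℝ} (hr : 0 < r)
    (hR : r < R) (hR2 : R ≤ 2 * r) {h : Eu n → ℝ} (hh : ContDiff ℝ 1 h) :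
    ∫ y, |h y - ⨍ z in closedBall x R, h z| * ‖fderiv ℝ (radialCutoff x r R) y‖ ≤
      (n * 2 ^ (n + 2) + 2) * ∫ y in closedBall x R, ‖fderiv ℝ h y‖ := by
  set c := ⨍ z in closedBall x R, h z with hc
  set ζ := radialCutoff x r R with hζ
  set B := closedBall x R with hB
  have hK : IsCompact B := isCompact_closedBall x R
  have hBm : MeasurableSet B := measurableSet_closedBall
  have hBtop : volume B ≠ ⊤ := hK.measure_lt_top.ne
  have hζc : ContDiff ℝ 1 ζ := (contDiff_radialCutoff x r R).of_le (by exact_mod_cast le_top)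
  have hζs : HasCompactSupport ζ := hasCompactSupport_radialCutoff hr hR
  have hfζ : Continuous (fderiv ℝ ζ) := hζc.continuous_fderiv (by simp)
  have hfh : Continuous (fderiv ℝ h) := hh.continuous_fderiv (by simp)
  have hhc := hh.continuous
  set g : Eu n → ℝ := fun y => h y - c with hg
  have hgc : ContDiff ℝ 1 g := hh.sub contDiff_const
  have hgcont : Continuous g := hgc.continuous
  have hfg : ∀ y, fderiv ℝ g y = fderiv ℝ h y := fun y => fderiv_sub_const c
  have habs : IntegrableOn (fun y => |g y|) B :=
    hgcont.abs.continuousOn.integrableOn_compact hK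
  have hG : IntegrableOn (fun y => ‖fderiv ℝ h y‖) B :=
    hfh.norm.continuousOn.integrableOn_compact hK
  have hε : ∀ ε > 0, r * ∫ y, |g y| * ‖fderiv ℝ ζ y‖ ≤
      n * (∫ y in B, |g y|) + R * (∫ y in B, ‖fderiv ℝ h y‖) + n * volume.real B * ε := by
    intro ε hε
    have hqc := contDiff_smoothAbs hε hgc
    have hqcont := hqc.continuous
    have hfq : Continuous (fderiv ℝ (smoothAbs ε g)) := hqc.continuous_fderiv (by simp)
    have h1 := integral_mul_norm_fderiv_radialCutoff_le (x := x) hr hR hqc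
      fun y => (abs_nonneg _).trans (abs_le_smoothAbs ε g y)
    have h2 : ∫ y, |g y| * ‖fderiv ℝ ζ y‖ ≤ ∫ y, smoothAbs ε g y * ‖fderiv ℝ ζ y‖ := by
      refine integral_mono
        (Continuous.integrable_of_hasCompactSupport (by fun_prop) (hζs.fderiv ℝ).norm.mul_left)
        (Continuous.integrable_of_hasCompactSupport (by fun_prop) (hζs.fderiv ℝ).norm.mul_left)
        fun y => ?_
      exact mul_le_mul_of_nonneg_right (abs_le_smoothAbs ε g y) (norm_nonneg _)
    have h3 : ∫ y in B, smoothAbs ε g y ≤ (∫ y in B, |g y|) + volume.real B * ε := by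
      have hconst : IntegrableOn (fun _ : Eu n => ε) B := integrableOn_const hBtop
      calc ∫ y in B, smoothAbs ε g y ≤ ∫ y in B, (|g y| + ε) :=
            setIntegral_mono (hqcont.continuousOn.integrableOn_compact hK) (habs.add hconst)
              fun y => smoothAbs_le hε g y
        _ = _ := by rw [integral_add habs hconst, setIntegral_const, smul_eq_mul]
    have h4 : ∫ y in B, ‖fderiv ℝ (smoothAbs ε g) y‖ ≤ ∫ y in B, ‖fderiv ℝ h y‖ :=
      setIntegral_mono (hfq.norm.continuousOn.integrableOn_compact hK) hG fun y => by
        simpa only [hfg] using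
          norm_fderiv_smoothAbs_le hε y (hgc.differentiable (by simp) y)
    have h5 : (n : ℝ) * ∫ y in B, smoothAbs ε g y ≤
        n * ((∫ y in B, |g y|) + volume.real B * ε) := by gcongr
    have h6 : R * ∫ y in B, ‖fderiv ℝ (smoothAbs ε g) y‖ ≤ R * ∫ y in B, ‖fderiv ℝ h y‖ :=
      mul_le_mul_of_nonneg_left h4 (by linarith)
    have h7 := mul_le_mul_of_nonneg_left h2 hr.le
    linarith
  have hlim : r * ∫ y, |g y| * ‖fderiv ℝ ζ y‖ ≤
      n * (∫ y in B, |g y|) + R * (∫ y in B, ‖fderiv ℝ h y‖) := by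
    have ht : Tendsto (fun ε : ℝ => n * (∫ y in B, |g y|) + R * (∫ y in B, ‖fderiv ℝ h y‖) +
        n * volume.real B * ε) (𝓝[>] 0) (𝓝 (n * (∫ y in B, |g y|) +
        R * (∫ y in B, ‖fderiv ℝ h y‖) + n * volume.real B * 0)) :=
      (Continuous.tendsto (by fun_prop) _).mono_left nhdsWithin_le_nhds
    rw [mul_zero, add_zero] at ht
    exact ge_of_tendsto ht (by filter_upwards [self_mem_nhdsWithin] with ε h using hε ε h)
  have hpoin := integral_abs_sub_average_le hh x (hr.trans hR)
  set G := ∫ y in B, ‖fderiv ℝ h y‖ with hGdef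
  have hG0 : 0 ≤ G := integral_nonneg fun _ => norm_nonneg _
  refine le_of_mul_le_mul_left ?_ hr
  calc r * ∫ y, |g y| * ‖fderiv ℝ ζ y‖ ≤ n * (2 ^ (n + 1) * R * G) + R * G := by
        refine hlim.trans ?_
        gcongr
    _ = R * ((n * 2 ^ (n + 1) + 1) * G) := by ring
    _ ≤ (2 * r) * ((n * 2 ^ (n + 1) + 1) * G) := by gcongr
    _ = _ := by ring

lemma norm_gradient {n : ℕ} (φ : Eu n → ℝ) (x : Eu n) : ‖gradient φ x‖ = ‖fderiv ℝ φ x‖ :=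
  LinearIsometryEquiv.norm_map _ _

lemma IsTest.continuous_fderiv {n : ℕ} {Ω : Set (Eu n)} {φ : Eu n → ℝ} (hφ : IsTest Ω φ) :
    Continuous (fderiv ℝ φ) := hφ.1.continuous_fderiv (by simp)

lemma IsTest.integrable_norm_fderiv {n : ℕ} {Ω : Set (Eu n)} {φ : Eu n → ℝ} (hφ : IsTest Ω φ) :
    Integrable fun x => ‖fderiv ℝ φ x‖ :=
  hφ.continuous_fderiv.norm.integrable_of_hasCompactSupport (hφ.2.1.fderiv ℝ).norm

lemma LocFinOn.integrable {n : ℕ} {Ω : Set (Eu n)} {μ : Measure (Eu n)} (hμ : LocFinOn Ω μ)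
    {φ : Eu n → ℝ} (hφ : IsTest Ω φ) : Integrable φ μ := by
  obtain ⟨M, hM⟩ := hφ.2.1.exists_bound_of_continuous hφ.1.continuous
  rw [← integrableOn_iff_integrable_of_support_subset (subset_tsupport φ)]
  exact Measure.integrableOn_of_bounded (hμ.1 _ hφ.2.2 hφ.2.1).ne
    hφ.1.continuous.aestronglyMeasurable (ae_of_all _ hM)

lemma IsTest.continuous_gradient {n : ℕ} {Ω : Set (Eu n)} {φ : Eu n → ℝ} (hφ : IsTest Ω φ) :
    Continuous (gradient φ) :=
  (InnerProductSpace.toDual ℝ (Eu n)).symm.continuous.comp hφ.continuous_fderiv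

lemma IsTest.integrable_gradient {n : ℕ} {Ω : Set (Eu n)} {φ : Eu n → ℝ} (hφ : IsTest Ω φ) :
    Integrable (gradient φ) := by
  refine (integrable_norm_iff hφ.continuous_gradient.aestronglyMeasurable).1 ?_
  simpa only [norm_gradient] using hφ.integrable_norm_fderiv

lemma Bdd.norm_integral_inner_le {n : ℕ} {Ω : Set (Eu n)} {σ : Eu n → Eu n} {C : ℝ}
    (hσ : Bdd Ω σ C) {F : Eu n → Eu n} (hF : Integrable F) :
    ‖∫ x in Ω, ⟪σ x, F x⟫‖ ≤ |C| * ∫ x, ‖F x‖ := by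
  have hint : Integrable fun x => |C| * ‖F x‖ := hF.norm.const_mul _
  rw [← integral_const_mul]
  refine (norm_integral_le_of_norm_le hint.integrableOn ?_).trans
    (setIntegral_le_integral hint (ae_of_all _ fun x => by positivity))
  filter_upwards [hσ.2] with x hx
  exact (norm_inner_le_norm _ _).trans (by gcongr; exact hx.trans (le_abs_self C))

lemma integral_le_mul_integral_norm_fderiv {n : ℕ} {Ω : Set (Eu n)} {σ : Eu n → Eu n} {C : ℝ}
    (hσ : Bdd Ω σ C) {μ : Measure (Eu n)} (hrep : RepNegDiv Ω σ μ 0) {φ : Eu n → ℝ}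
    (hφ : IsTest Ω φ) : ∫ x, φ x ∂μ ≤ |C| * ∫ x, ‖fderiv ℝ φ x‖ := by
  have h := hrep φ hφ
  rw [integral_zero_measure, sub_zero] at h
  rw [← h]
  simpa only [norm_gradient] using
    (Real.le_norm_self _).trans (hσ.norm_integral_inner_le hφ.integrable_gradient)

lemma measure_closedBall_le_integral {n : ℕ} {μ : Measure (Eu n)} {ζ : Eu n → ℝ}
    (hζ : Integrable ζ μ) (h0 : ∀ y, 0 ≤ ζ y) {x : Eu n} {r : ℝ}
    (h1 : ∀ y ∈ closedBall x r, ζ y = 1) :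
    μ (closedBall x r) ≤ ENNReal.ofReal (∫ y, ζ y ∂μ) := by
  rw [ofReal_integral_eq_lintegral_ofReal hζ (ae_of_all _ h0),
    ← lintegral_indicator_one measurableSet_closedBall]
  refine lintegral_mono fun y => ?_
  by_cases hy : y ∈ closedBall x r
  · simp [hy, h1 y hy]
  · simp [hy]

lemma isTest_radialCutoff {n : ℕ} {Ω : Set (Eu n)} {x : Eu n} {r R : ℝ} (hr : 0 < r)
    (hR : r < R) (h : closedBall x R ⊆ Ω) : IsTest Ω (radialCutoff x r R) :=
  ⟨contDiff_radialCutoff _ _ _, hasCompactSupport_radialCutoff hr hR,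
    (tsupport_radialCutoff_subset hr hR).trans h⟩

lemma volumeReal_closedBall {n : ℕ} (x : Eu n) {r : ℝ} (hr : 0 ≤ r) :
    volume.real (closedBall x r) = r ^ n * volume.real (ball (0 : Eu n) 1) := by
  rw [measureReal_def, Measure.addHaar_closedBall _ _ hr, ENNReal.toReal_mul,
    ENNReal.toReal_ofReal (by positivity), finrank_euclideanSpace_fin, measureReal_def]

lemma measure_closedBall_le_rpow {n : ℕ} {Ω : Set (Eu n)} {σ : Eu n → Eu n} {C : ℝ}
    (hσ : Bdd Ω σ C) {μ : Measure (Eu n)} (hμ : LocFinOn Ω μ) (hrep : RepNegDiv Ω σ μ 0)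
    {x : Eu n} {ρ : ℝ} (hρ : 0 < ρ) (hsub : closedBall x (2 * ρ) ⊆ Ω) :
    μ (closedBall x ρ) ≤
      ENNReal.ofReal (|C| * (n * 2 ^ n * volume.real (ball (0 : Eu n) 1)) + 1) *
        ENNReal.ofReal ρ ^ ((n : ℝ) - 1) := by
  have hR : ρ < 2 * ρ := by linarith
  have ht := isTest_radialCutoff hρ hR hsub
  have h1 := measure_closedBall_le_integral (hμ.integrable ht) (radialCutoff_nonneg x ρ (2 * ρ))
    (fun y hy => radialCutoff_eq_one hρ hR hy)
  have h2 := integral_le_mul_integral_norm_fderiv hσ hrep ht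
  have h3 := integral_mul_norm_fderiv_radialCutoff_le (x := x) hρ hR
    (contDiff_const (c := (1 : ℝ))) fun _ => zero_le_one
  simp only [one_mul, fderiv_fun_const, Pi.zero_apply, norm_zero, integral_zero, mul_zero,
    add_zero, setIntegral_const, smul_eq_mul, mul_one] at h3
  rw [volumeReal_closedBall x (by positivity)] at h3
  set w := volume.real (ball (0 : Eu n) 1)
  have hw : 0 ≤ w := measureReal_nonneg
  have h4 : ∫ y, ‖fderiv ℝ (radialCutoff x ρ (2 * ρ)) y‖ ≤ n * 2 ^ n * w * ρ ^ ((n : ℝ) - 1) := by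
    rw [Real.rpow_sub_one hρ.ne', Real.rpow_natCast]
    refine le_of_mul_le_mul_left (h3.trans_eq ?_) hρ
    rw [mul_pow]
    field_simp
  rw [ENNReal.ofReal_rpow_of_pos hρ, ← ENNReal.ofReal_mul (by positivity)]
  refine h1.trans (ENNReal.ofReal_le_ofReal (h2.trans ?_))
  have h5 : 0 ≤ ρ ^ ((n : ℝ) - 1) := by positivity
  calc |C| * ∫ y, ‖fderiv ℝ (radialCutoff x ρ (2 * ρ)) y‖
      ≤ |C| * (n * 2 ^ n * w * ρ ^ ((n : ℝ) - 1)) := by gcongr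
    _ ≤ _ := by linarith

lemma exists_forall_closedBall_subset {n : ℕ} {Ω K : Set (Eu n)} (hΩ : IsOpen Ω)
    (hK : IsCompact K) (hKΩ : K ⊆ Ω) :
    ∃ R > 0, R ≤ 1 ∧ ∀ x ∈ K, closedBall x (2 * R) ⊆ Ω := by
  obtain ⟨δ, hδ, h⟩ := hK.exists_cthickening_subset_open hΩ hKΩ
  refine ⟨min 1 (δ / 2), by positivity, min_le_left _ _, fun x hx => ?_⟩
  refine (closedBall_subset_closedBall ?_).trans ((closedBall_subset_cthickening hx δ).trans h)
  linarith [min_le_right 1 (δ / 2)]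

lemma measure_inter_eq_zero_of_repNegDiv {n : ℕ} {Ω : Set (Eu n)} (hΩ : IsOpen Ω)
    {σ : Eu n → Eu n} {C : ℝ} (hσ : Bdd Ω σ C) {μ : Measure (Eu n)} (hμ : LocFinOn Ω μ)
    (hrep : RepNegDiv Ω σ μ 0) {K s : Set (Eu n)} (hK : IsCompact K) (hKΩ : K ⊆ Ω)
    (hs : hm n s = 0) : μ (s ∩ K) = 0 := by
  obtain ⟨R, hR, -, h⟩ := exists_forall_closedBall_subset hΩ hK hKΩ
  refine measure_inter_eq_zero_of_hm_eq_zero hK.measurableSet hR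
    (M := |C| * (n * 2 ^ n * volume.real (ball (0 : Eu n) 1)) + 1) (by positivity)
    (fun x hx ρ hρ => measure_closedBall_le_rpow hσ hμ hrep hρ.1 ?_) hs
  exact (closedBall_subset_closedBall (by linarith [hρ.2])).trans (h x hx)

lemma volume_eq_zero_of_hm_eq_zero {n : ℕ} {s : Set (Eu n)} (hs : hm n s = 0) :
    volume s = 0 := by
  rw [← inter_univ s]
  set w := volume.real (ball (0 : Eu n) 1)
  refine measure_inter_eq_zero_of_hm_eq_zero MeasurableSet.univ one_pos (M := w + 1)
    (by positivity) (fun x _ ρ hρ => ?_) hs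
  have hρ0 := hρ.1
  rw [Measure.addHaar_closedBall _ _ hρ.1.le, finrank_euclideanSpace_fin,
    ENNReal.ofReal_rpow_of_pos hρ.1, mul_comm]
  gcongr
  · rw [← ofReal_measureReal]
    exact ENNReal.ofReal_le_ofReal (by simp [w])
  · rw [← Real.rpow_natCast]
    exact Real.rpow_le_rpow_of_exponent_ge hρ.1 hρ.2.le (by linarith)

lemma integral_fderiv_glue_le {n : ℕ} {h : Eu n → ℝ} (hh : ContDiff ℝ (⊤ : ℕ∞) h)
    (hhs : HasCompactSupport h) {t : Finset (Eu n)} {r R : Eu n → ℝ}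
    (hr : ∀ x ∈ t, 0 < r x) (hR : ∀ x ∈ t, r x < R x) (hR2 : ∀ x ∈ t, R x ≤ 2 * r x)
    (hdisj : (t : Set (Eu n)).PairwiseDisjoint fun x => closedBall x (R x))
    (hsum : ∀ y, ∑ x ∈ t, radialCutoff x (r x) (R x) y ≤ 1) :
    ∫ y, ‖fderiv ℝ (fun y => h y + ∑ x ∈ t, radialCutoff x (r x) (R x) y *
      ((⨍ z in closedBall x (R x), h z) - h y)) y‖ ≤
      (n * 2 ^ (n + 2) + 3) * ∫ y, ‖fderiv ℝ h y‖ := by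
  set ζ : Eu n → Eu n → ℝ := fun x => radialCutoff x (r x) (R x) with hζ
  set c : Eu n → ℝ := fun x => ⨍ z in closedBall x (R x), h z with hc
  have hζc : ∀ x, ContDiff ℝ (⊤ : ℕ∞) (ζ x) := fun x => contDiff_radialCutoff _ _ _
  have hdh : Differentiable ℝ h := hh.differentiable (by simp)
  have hfh : Continuous (fderiv ℝ h) := hh.continuous_fderiv (by simp)
  have hcont := hh.continuous
  have hint : Integrable fun y => ‖fderiv ℝ h y‖ :=
    hfh.norm.integrable_of_hasCompactSupport (hhs.fderiv ℝ).norm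
  have hζint : ∀ x ∈ t, Integrable fun y => |h y - c x| * ‖fderiv ℝ (ζ x) y‖ := fun x hx => by
    have : Continuous (fderiv ℝ (ζ x)) := (hζc x).continuous_fderiv (by simp)
    exact Continuous.integrable_of_hasCompactSupport (by fun_prop)
      ((hasCompactSupport_radialCutoff (hr x hx) (hR x hx)).fderiv ℝ).norm.mul_left
  have hpt : ∀ y, ‖fderiv ℝ (fun y => h y + ∑ x ∈ t, ζ x y * (c x - h y)) y‖ ≤
      ‖fderiv ℝ h y‖ + ∑ x ∈ t, |h y - c x| * ‖fderiv ℝ (ζ x) y‖ := fun y => by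
    have hd : HasFDerivAt (fun y => h y + ∑ x ∈ t, ζ x y * (c x - h y))
        (fderiv ℝ h y + ∑ x ∈ t, (ζ x y • (-fderiv ℝ h y) + (c x - h y) • fderiv ℝ (ζ x) y)) y :=
      (hdh y).hasFDerivAt.add (HasFDerivAt.fun_sum fun x _ =>
        (((hζc x).differentiable (by simp)) y).hasFDerivAt.mul
          ((hdh y).hasFDerivAt.const_sub (c x)))
    have heq : fderiv ℝ h y + ∑ x ∈ t, (ζ x y • (-fderiv ℝ h y) + (c x - h y) • fderiv ℝ (ζ x) y)
        = (1 - ∑ x ∈ t, ζ x y) • fderiv ℝ h y + ∑ x ∈ t, (c x - h y) • fderiv ℝ (ζ x) y := by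
      rw [Finset.sum_add_distrib, sub_smul, one_smul, Finset.sum_smul]
      simp only [smul_neg, Finset.sum_neg_distrib]
      abel
    rw [hd.fderiv, heq]
    refine (norm_add_le _ _).trans (add_le_add ?_ ((norm_sum_le _ _).trans_eq ?_))
    · rw [norm_smul, Real.norm_of_nonneg (by linarith [hsum y])]
      refine mul_le_of_le_one_left (norm_nonneg _) ?_
      linarith [Finset.sum_nonneg fun x (_ : x ∈ t) => radialCutoff_nonneg x (r x) (R x) y]
    · refine Finset.sum_congr rfl fun x _ => ?_
      rw [norm_smul, Real.norm_eq_abs, abs_sub_comm]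
  calc _ ≤ ∫ y, (‖fderiv ℝ h y‖ + ∑ x ∈ t, |h y - c x| * ‖fderiv ℝ (ζ x) y‖) :=
        integral_mono_of_nonneg (ae_of_all _ fun _ => norm_nonneg _)
          (hint.add (integrable_finsetSum _ hζint)) (ae_of_all _ hpt)
    _ = (∫ y, ‖fderiv ℝ h y‖) + ∑ x ∈ t, ∫ y, |h y - c x| * ‖fderiv ℝ (ζ x) y‖ := by
        rw [integral_add hint (integrable_finsetSum _ hζint), integral_finsetSum _ hζint]
    _ ≤ (∫ y, ‖fderiv ℝ h y‖) +
          ∑ x ∈ t, (n * 2 ^ (n + 2) + 2) * ∫ y in closedBall x (R x), ‖fderiv ℝ h y‖ := by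
        gcongr with x hx
        exact integral_abs_sub_average_mul_norm_fderiv_le (hr x hx) (hR x hx) (hR2 x hx)
          (hh.of_le (by simp))
    _ = (∫ y, ‖fderiv ℝ h y‖) +
          (n * 2 ^ (n + 2) + 2) * ∫ y in ⋃ x ∈ t, closedBall x (R x), ‖fderiv ℝ h y‖ := by
        rw [integral_biUnion_finset t (fun _ _ => measurableSet_closedBall) hdisj
          (fun _ _ => hint.integrableOn), Finset.mul_sum]
    _ ≤ (∫ y, ‖fderiv ℝ h y‖) + (n * 2 ^ (n + 2) + 2) * ∫ y, ‖fderiv ℝ h y‖ := by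
        refine add_le_add le_rfl (mul_le_mul_of_nonneg_left ?_ (by positivity))
        exact setIntegral_le_integral hint (ae_of_all _ fun _ => norm_nonneg _)
    _ = _ := by ring

lemma radialCutoff_eq_zero_of_disjoint {n : ℕ} {t : Finset (Eu n)} {r R : Eu n → ℝ}
    (hr : ∀ x ∈ t, 0 < r x) (hR : ∀ x ∈ t, r x < R x)
    (hdisj : (t : Set (Eu n)).PairwiseDisjoint fun x => closedBall x (R x)) {x x' y : Eu n}
    (hx : x ∈ t) (hx' : x' ∈ t) (hne : x' ≠ x) (hy : y ∈ closedBall x (R x)) :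
    radialCutoff x' (r x') (R x') y = 0 :=
  radialCutoff_eq_zero (hr x' hx') (hR x' hx') fun h =>
    (Set.disjoint_left.1 (hdisj hx' hx hne) (ball_subset_closedBall h)) hy

lemma mul_measureReal_biUnion_le {n : ℕ} {Ω : Set (Eu n)} {σ : Eu n → Eu n} {C : ℝ}
    (hσ : Bdd Ω σ C) {μ : Measure (Eu n)} (hμ : LocFinOn Ω μ) (hrep : RepNegDiv Ω σ μ 0)
    {h : Eu n → ℝ} (hh : IsTest Ω h) (h0 : ∀ y, 0 ≤ h y) {t : Finset (Eu n)} {r R : Eu n → ℝ}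
    (hr : ∀ x ∈ t, 0 < r x) (hR : ∀ x ∈ t, r x < R x) (hR2 : ∀ x ∈ t, R x ≤ 2 * r x)
    (hΩ : ∀ x ∈ t, closedBall x (R x) ⊆ Ω)
    (hdisj : (t : Set (Eu n)).PairwiseDisjoint fun x => closedBall x (R x))
    {c : ℝ} (hc0 : 0 ≤ c) (hc : ∀ x ∈ t, c ≤ ⨍ z in closedBall x (R x), h z) :
    c * μ.real (⋃ x ∈ t, closedBall x (r x)) ≤
      |C| * ((n * 2 ^ (n + 2) + 3) * ∫ y, ‖fderiv ℝ h y‖) := by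
  have hzero := fun {x x' y : Eu n} => radialCutoff_eq_zero_of_disjoint (x := x) (x' := x')
    (y := y) hr hR hdisj
  have hsum : ∀ y, ∑ x ∈ t, radialCutoff x (r x) (R x) y ≤ 1 := fun y => by
    by_cases hy : ∃ x ∈ t, y ∈ closedBall x (R x)
    · obtain ⟨x, hx, hxy⟩ := hy
      rw [Finset.sum_eq_single_of_mem x hx fun x' hx' hne => hzero hx hx' hne hxy]
      exact radialCutoff_le_one _ _ _ _
    · push Not at hy
      rw [Finset.sum_eq_zero fun x hx => radialCutoff_eq_zero (hr x hx) (hR x hx)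
        fun hb => hy x hx (ball_subset_closedBall hb)]
      exact zero_le_one
  set m : Eu n → ℝ := fun x => ⨍ z in closedBall x (R x), h z
  set W : Eu n → ℝ := fun y => h y + ∑ x ∈ t, radialCutoff x (r x) (R x) y * (m x - h y) with hW
  set S : Set (Eu n) := tsupport h ∪ ⋃ x ∈ t, closedBall x (R x)
  have hScomp : IsCompact S :=
    hh.2.1.isCompact.union (t.isCompact_biUnion fun x _ => isCompact_closedBall x (R x))
  have hsupp : Function.support W ⊆ S := by
    refine Function.support_subset_iff'.2 fun y hy => ?_
    have hy1 : h y = 0 := image_eq_zero_of_notMem_tsupport fun h => hy (Or.inl h)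
    rw [hW]
    simp only [hy1, zero_add]
    refine Finset.sum_eq_zero fun x hx => ?_
    rw [radialCutoff_eq_zero (hr x hx) (hR x hx) fun hb => hy (Or.inr (mem_biUnion hx
      (ball_subset_closedBall hb))), zero_mul]
  have htest : IsTest Ω W := by
    refine ⟨hh.1.add (ContDiff.sum fun x _ =>
      (contDiff_radialCutoff _ _ _).mul (contDiff_const.sub hh.1)),
      HasCompactSupport.of_support_subset_isCompact hScomp hsupp,
      (closure_minimal hsupp hScomp.isClosed).trans ?_⟩
    exact union_subset hh.2.2 (iUnion₂_subset hΩ)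
  have hW0 : ∀ y, 0 ≤ W y := fun y => by
    have : W y = (1 - ∑ x ∈ t, radialCutoff x (r x) (R x) y) * h y +
        ∑ x ∈ t, radialCutoff x (r x) (R x) y * m x := by
      simp only [hW, mul_sub, Finset.sum_sub_distrib, sub_mul, Finset.sum_mul]
      ring
    rw [this]
    exact add_nonneg (mul_nonneg (by linarith [hsum y]) (h0 y)) (Finset.sum_nonneg fun x hx =>
      mul_nonneg (radialCutoff_nonneg _ _ _ _) (hc0.trans (hc x hx)))
  set U := ⋃ x ∈ t, closedBall x (r x)
  have hUm : MeasurableSet U := t.measurableSet_biUnion fun _ _ => measurableSet_closedBall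
  have hUfin : μ U < ⊤ := by
    refine hμ.1 U (iUnion₂_subset fun x hx =>
      (closedBall_subset_closedBall (hR x hx).le).trans (hΩ x hx))
      (t.isCompact_biUnion fun x _ => isCompact_closedBall x (r x))
  have hWU : ∀ y ∈ U, c ≤ W y := fun y hy => by
    obtain ⟨x, hx, hxy⟩ := mem_iUnion₂.1 hy
    simp only [hW]
    rw [Finset.sum_eq_single_of_mem x hx fun x' hx' hne => by
      rw [hzero hx hx' hne (closedBall_subset_closedBall (hR x hx).le hxy), zero_mul],
      radialCutoff_eq_one (hr x hx) (hR x hx) hxy]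
    linarith [hc x hx]
  have hWint := hμ.integrable htest
  have hconst : IntegrableOn (fun _ : Eu n => c) U μ := integrableOn_const hUfin.ne
  calc c * μ.real U = ∫ y in U, c ∂μ := by rw [setIntegral_const, smul_eq_mul, mul_comm]
    _ ≤ ∫ y in U, W y ∂μ := setIntegral_mono_on hconst hWint.integrableOn hUm hWU
    _ ≤ ∫ y, W y ∂μ := setIntegral_le_integral hWint (ae_of_all _ hW0)
    _ ≤ |C| * ∫ y, ‖fderiv ℝ W y‖ := integral_le_mul_integral_norm_fderiv hσ hrep htest
    _ ≤ _ := by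
        gcongr
        exact integral_fderiv_glue_le hh.1 hh.2.1 hr hR hR2 hdisj hsum

lemma volumeReal_closedBall_pos {n : ℕ} (x : Eu n) {r : ℝ} (hr : 0 < r) :
    0 < volume.real (closedBall x r) :=
  ENNReal.toReal_pos (measure_closedBall_pos _ _ hr).ne' measure_closedBall_lt_top.ne

lemma average_closedBall_le {n : ℕ} {h : Eu n → ℝ} (hc : Continuous h) (h0 : ∀ y, 0 ≤ h y)
    (x : Eu n) {r R : ℝ} (hr : 0 < r) (hR : r ≤ R) (hR2 : R ≤ 2 * r) :
    (2 ^ n)⁻¹ * ⨍ y in closedBall x r, h y ≤ ⨍ y in closedBall x R, h y := by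
  have hpr := volumeReal_closedBall_pos x hr
  have hpR := volumeReal_closedBall_pos x (hr.trans_le hR)
  have hle : volume.real (closedBall x R) ≤ 2 ^ n * volume.real (closedBall x r) := by
    rw [volumeReal_closedBall x hr.le, volumeReal_closedBall x (hr.le.trans hR), ← mul_assoc,
      ← mul_pow]
    have hR0 := hr.le.trans hR
    gcongr
  have hint : IntegrableOn h (closedBall x R) :=
    hc.continuousOn.integrableOn_compact (isCompact_closedBall x R)
  have hmono : ∫ y in closedBall x r, h y ≤ ∫ y in closedBall x R, h y :=
    setIntegral_mono_set hint (ae_of_all _ h0) (closedBall_subset_closedBall hR).eventuallyLE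
  rw [setAverage_eq, setAverage_eq, smul_eq_mul, smul_eq_mul, ← mul_assoc, ← mul_inv]
  refine mul_le_mul ?_ hmono (integral_nonneg h0) (by positivity)
  exact inv_anti₀ hpR hle

lemma eventually_pairwiseDisjoint_closedBall {n : ℕ} (t : Finset (Eu n)) {r : Eu n → ℝ}
    (hr : ∀ x ∈ t, 0 < r x)
    (hdisj : (t : Set (Eu n)).PairwiseDisjoint fun x => closedBall x (r x)) :
    ∀ᶠ δ in 𝓝[>] (0 : ℝ),
      (t : Set (Eu n)).PairwiseDisjoint fun x => closedBall x ((1 + δ) * r x) := by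
  have : ∀ x ∈ t, ∀ y ∈ t, ∀ᶠ δ in 𝓝[>] (0 : ℝ), x ≠ y →
      (1 + δ) * r x + (1 + δ) * r y < dist x y := fun x hx y hy => by
    by_cases hxy : x = y
    · exact Eventually.of_forall fun _ h => absurd hxy h
    have h1 := (disjoint_closedBall_closedBall_iff (hr x hx).le (hr y hy).le).1 (hdisj hx hy hxy)
    have h2 : Tendsto (fun δ : ℝ => (1 + δ) * r x + (1 + δ) * r y) (𝓝[>] 0)
        (𝓝 ((1 + 0) * r x + (1 + 0) * r y)) :=
      (Continuous.tendsto (by fun_prop) _).mono_left nhdsWithin_le_nhds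
    rw [add_zero, one_mul, one_mul] at h2
    filter_upwards [h2.eventually_lt_const h1] with δ hδ _ using hδ
  have h2 := (Finset.eventually_all t).2 fun x hx => (Finset.eventually_all t).2 (this x hx)
  filter_upwards [h2, self_mem_nhdsWithin] with δ hδ hδ0 x hx y hy hxy
  have hδ1 : 0 < 1 + δ := add_pos one_pos hδ0
  exact (disjoint_closedBall_closedBall_iff (mul_pos hδ1 (hr x hx)).le
    (mul_pos hδ1 (hr y hy)).le).2 (hδ x hx y hy hxy)

/-- Weak-type estimate for the maximal function with respect to a divergence measure. -/
lemma exists_measure_le_of_lt_average {n : ℕ} {Ω : Set (Eu n)} {σ : Eu n → Eu n} {C : ℝ}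
    (hσ : Bdd Ω σ C) {μ : Measure (Eu n)} (hμ : LocFinOn Ω μ) (hrep : RepNegDiv Ω σ μ 0) :
    ∃ M : ℝ, 0 ≤ M ∧ ∀ (f : Eu n → ℝ) (K A : Set (Eu n)) (R θ : ℝ), IsTest Ω f →
      IsCompact K → K ⊆ Ω → 0 < R → R ≤ 1 → (∀ x ∈ K, closedBall x (2 * R) ⊆ Ω) → 0 < θ →
      A ⊆ K → (∀ x ∈ A, ∃ r ∈ Ioc 0 R, θ < ⨍ y in closedBall x r, |f y|) →
      μ A ≤ ENNReal.ofReal (M / θ * ∫ y, ‖fderiv ℝ f y‖) := by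
  obtain ⟨N, τ, hτ, hN⟩ := HasBesicovitchCovering.no_satelliteConfig (α := Eu n)
  refine ⟨(N + 1) * (2 ^ (n + 1) * (|C| * (n * 2 ^ (n + 2) + 3))), by positivity, ?_⟩
  intro f K A R θ hf hK hKΩ hR hR1 hball hθ hAK hA
  choose! r hr hlt using hA
  have hKfin : μ K < ⊤ := hμ.1 K hKΩ hK
  have : IsFiniteMeasure (μ.restrict K) := ⟨by rwa [Measure.restrict_apply_univ]⟩
  obtain ⟨t, htA, htμ, htd⟩ := Besicovitch.exist_finset_disjoint_balls_large_measure
    (μ.restrict K) hτ hN A r (fun x hx => (hr x hx).1) (fun x hx => (hr x hx).2.trans hR1)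
  set U := ⋃ x ∈ t, closedBall x (r x)
  have hrt : ∀ x ∈ t, 0 < r x := fun x hx => (hr x (htA hx)).1
  obtain ⟨δ, hδd, hδ⟩ := ((eventually_pairwiseDisjoint_closedBall t hrt htd).and
    (Ioc_mem_nhdsGT (zero_lt_one' ℝ))).exists
  have hUsub : ∀ x ∈ t, closedBall x ((1 + δ) * r x) ⊆ Ω := fun x hx =>
    (closedBall_subset_closedBall (by nlinarith [hδ.1, hδ.2, hrt x hx, (hr x (htA hx)).2])).trans
      (hball x (hAK (htA hx)))
  have hrR : ∀ x ∈ t, r x < (1 + δ) * r x := fun x hx => by nlinarith [hδ.1, hrt x hx]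
  have hrR2 : ∀ x ∈ t, (1 + δ) * r x ≤ 2 * r x := fun x hx => by nlinarith [hδ.2, hrt x hx]
  set ε := θ / 2 with hεdef
  have hε : 0 < ε := by positivity
  set h : Eu n → ℝ := fun y => smoothAbs ε f y - ε with hh
  have h0 : ∀ y, 0 ≤ h y := fun y => sub_nonneg.2 (le_smoothAbs ε f y)
  have hsupp : Function.support h ⊆ tsupport f := by
    refine Function.support_subset_iff'.2 fun y hy => ?_
    simp [hh, smoothAbs, image_eq_zero_of_notMem_tsupport hy, Real.sqrt_sq hε.le]
  have htest : IsTest Ω h :=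
    ⟨(contDiff_smoothAbs hε hf.1).sub contDiff_const,
      HasCompactSupport.of_support_subset_isCompact hf.2.1.isCompact hsupp,
      (closure_minimal hsupp (isClosed_tsupport f)).trans hf.2.2⟩
  have hgrad : ∫ y, ‖fderiv ℝ h y‖ ≤ ∫ y, ‖fderiv ℝ f y‖ := by
    refine integral_mono htest.integrable_norm_fderiv hf.integrable_norm_fderiv fun y => ?_
    simp only [hh, fderiv_sub_const]
    exact norm_fderiv_smoothAbs_le hε y (hf.1.differentiable (by simp) y)
  have hfc := hf.1.continuous
  have hc : ∀ x ∈ t, θ / 2 ^ (n + 1) ≤ ⨍ z in closedBall x ((1 + δ) * r x), h z := fun x hx => by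
    refine le_trans ?_ (average_closedBall_le htest.1.continuous h0 x (hrt x hx) (hrR x hx).le
      (hrR2 x hx))
    have hpos := volumeReal_closedBall_pos x (hrt x hx)
    have hlt' := hlt x (htA hx)
    have hcK := isCompact_closedBall x (r x)
    have hi1 : IntegrableOn (fun y => |f y|) (closedBall x (r x)) :=
      hfc.abs.continuousOn.integrableOn_compact hcK
    have hi2 : IntegrableOn (fun _ : Eu n => ε) (closedBall x (r x)) :=
      integrableOn_const measure_closedBall_lt_top.ne
    have hle : (⨍ y in closedBall x (r x), |f y|) - ε ≤ ⨍ y in closedBall x (r x), h y := by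
      rw [setAverage_eq, setAverage_eq, smul_eq_mul, smul_eq_mul]
      have : (∫ y in closedBall x (r x), |f y|) - volume.real (closedBall x (r x)) * ε ≤
          ∫ y in closedBall x (r x), h y := by
        rw [← smul_eq_mul (volume.real _), ← setIntegral_const, ← integral_sub hi1 hi2]
        exact setIntegral_mono (hi1.sub hi2)
          (htest.1.continuous.continuousOn.integrableOn_compact hcK)
          fun y => sub_le_sub_right (abs_le_smoothAbs ε f y) ε
      have h' := mul_le_mul_of_nonneg_left this (inv_nonneg.2 hpos.le)
      rwa [mul_sub, inv_mul_cancel_left₀ hpos.ne'] at h'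
    calc θ / 2 ^ (n + 1) = (2 ^ n)⁻¹ * (θ - ε) := by
          rw [hεdef, pow_succ]
          field_simp
          ring
      _ ≤ _ := mul_le_mul_of_nonneg_left (by linarith) (by positivity)
  have hmain := mul_measureReal_biUnion_le hσ hμ hrep htest h0 hrt hrR hrR2 hUsub hδd
    (by positivity) hc
  have hUle : μ.real U ≤ 2 ^ (n + 1) * (|C| * (n * 2 ^ (n + 2) + 3)) / θ *
      ∫ y, ‖fderiv ℝ f y‖ := by
    have hpos : 0 < θ / 2 ^ (n + 1) := by positivity
    refine le_of_mul_le_mul_left (hmain.trans ?_) hpos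
    calc |C| * ((n * 2 ^ (n + 2) + 3) * ∫ y, ‖fderiv ℝ h y‖)
        ≤ |C| * ((n * 2 ^ (n + 2) + 3) * ∫ y, ‖fderiv ℝ f y‖) := by gcongr
      _ = _ := by field_simp
  have hUfin : μ U ≠ ⊤ := (hμ.1 U (iUnion₂_subset fun x hx =>
    (closedBall_subset_closedBall (hrR x hx).le).trans (hUsub x hx))
      (t.isCompact_biUnion fun x _ => isCompact_closedBall x (r x))).ne
  have hAeq : (μ.restrict K) A = μ A := Measure.restrict_eq_self _ hAK
  have hAfin : μ A ≠ ⊤ := ((measure_mono hAK).trans_lt hKfin).ne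
  have hsplit : μ A ≤ μ U + N / (N + 1) * μ A := by
    rw [← hAeq]
    calc (μ.restrict K) A ≤ (μ.restrict K) (A ∩ U) + (μ.restrict K) (A \ U) :=
          measure_le_inter_add_sdiff _ _ _
      _ ≤ _ := add_le_add ((measure_mono inter_subset_right).trans (Measure.restrict_apply_le _ _))
          htμ
  have hsplit' : μ.real A ≤ μ.real U + N / (N + 1) * μ.real A := by
    have hfac : (N : ℝ≥0∞) / (N + 1) ≠ ⊤ := ENNReal.div_ne_top (by simp) (by simp)
    have := ENNReal.toReal_mono (ENNReal.add_ne_top.2 ⟨hUfin, ENNReal.mul_ne_top hfac hAfin⟩) hsplit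
    rwa [ENNReal.toReal_add hUfin (ENNReal.mul_ne_top hfac hAfin), ENNReal.toReal_mul,
      ENNReal.toReal_div, ENNReal.toReal_add (by simp) (by simp), ENNReal.toReal_natCast,
      ENNReal.toReal_one] at this
  have hAle : μ.real A ≤ (N + 1) * μ.real U := by
    have hN1 : (0 : ℝ) < N + 1 := by positivity
    have h1 : (N + 1) * μ.real A ≤ (N + 1) * (μ.real U + N / (N + 1) * μ.real A) := by gcongr
    have h2 : ((N : ℝ) + 1) * (μ.real U + N / (N + 1) * μ.real A) =
        (N + 1) * μ.real U + N * μ.real A := by field_simp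
    linarith
  rw [← ofReal_measureReal hAfin]
  refine ENNReal.ofReal_le_ofReal (hAle.trans ?_)
  calc ((N : ℝ) + 1) * μ.real U ≤ (N + 1) * (2 ^ (n + 1) * (|C| * (n * 2 ^ (n + 2) + 3)) / θ *
      ∫ y, ‖fderiv ℝ f y‖) := by gcongr
    _ = _ := by ring

open scoped Convolution in
lemma integral_norm_convolution_le {n : ℕ} {E : Type*} [NormedAddCommGroup E] [NormedSpace ℝ E]
    [CompleteSpace E] (b : ContDiffBump (0 : Eu n)) {F : Eu n → E} (hF : Integrable F) :
    ∫ x, ‖(b.normed volume ⋆[ContinuousLinearMap.lsmul ℝ ℝ, volume] F) x‖ ≤ ∫ x, ‖F x‖ := by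
  have hb : Integrable (b.normed volume) := b.integrable_normed
  have hconv := integral_convolution (μ := volume) (ν := volume)
    (ContinuousLinearMap.lsmul ℝ ℝ : ℝ →L[ℝ] ℝ →L[ℝ] ℝ) hb hF.norm
  rw [b.integral_normed] at hconv
  simp only [ContinuousLinearMap.lsmul_apply, one_smul] at hconv
  rw [← hconv]
  refine integral_mono_of_nonneg (ae_of_all _ fun _ => norm_nonneg _)
    (hb.integrable_convolution _ hF.norm) (ae_of_all _ fun x => ?_)
  refine (norm_integral_le_integral_norm _).trans_eq (integral_congr_ae (ae_of_all _ fun t => ?_))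
  simp [norm_smul, abs_of_nonneg (b.nonneg_normed (μ := volume) t)]

open scoped Convolution in
lemma tendsto_integral_norm_convolution_sub_of_continuous {n : ℕ} {E : Type*}
    [NormedAddCommGroup E] [NormedSpace ℝ E] [CompleteSpace E] {b : ℕ → ContDiffBump (0 : Eu n)}
    (hb : Tendsto (fun k => (b k).rOut) atTop (𝓝 0)) {g : Eu n → E} (hg : Continuous g)
    (hgs : HasCompactSupport g) :
    Tendsto (fun k => ∫ x, ‖((b k).normed volume ⋆[ContinuousLinearMap.lsmul ℝ ℝ, volume] g) x -
      g x‖) atTop (𝓝 0) := by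
  obtain ⟨B, hB⟩ := hgs.exists_bound_of_continuous hg
  set K := cthickening 1 (tsupport g)
  have hK : IsCompact K := hgs.isCompact.cthickening
  have hlim : Tendsto (fun k => ∫ x, ‖((b k).normed volume ⋆[ContinuousLinearMap.lsmul ℝ ℝ,
      volume] g) x - g x‖) atTop (𝓝 (∫ _ : Eu n, (0 : ℝ))) := by
    refine tendsto_integral_filter_of_dominated_convergence (K.indicator fun _ => 2 * B)
      (Eventually.of_forall fun k => ?_) ?_ ?_ (ae_of_all _ fun x => ?_)
    · exact (((b k).integrable_normed.integrable_convolution _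
        (hg.integrable_of_hasCompactSupport hgs)).aestronglyMeasurable.sub
          hg.aestronglyMeasurable).norm
    · filter_upwards [hb.eventually_lt_const one_pos] with k hk
      refine ae_of_all _ fun x => ?_
      rw [norm_norm, ← dist_eq_norm]
      refine (b k).dist_normed_convolution_le hg.aestronglyMeasurable fun y hy => ?_
      by_cases hx : x ∈ K
      · rw [indicator_of_mem hx, dist_eq_norm]
        linarith [norm_sub_le (g y) (g x), hB x, hB y]
      · have hzero : ∀ z ∈ ball x (b k).rOut, g z = 0 := fun z hz =>
          image_eq_zero_of_notMem_tsupport fun hz' => hx <|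
            closedBall_subset_cthickening hz' 1 (mem_closedBall'.2 (hz.le.trans hk.le))
        rw [indicator_of_notMem hx, hzero y hy, hzero x (mem_ball_self (b k).rOut_pos), dist_self]
    · rw [integrable_indicator_iff hK.measurableSet]
      exact integrableOn_const hK.measure_lt_top.ne
    · have := ContDiffBump.convolution_tendsto_right_of_continuous (μ := volume) hb hg x
      simpa using (tendsto_iff_norm_sub_tendsto_zero.1 this)
  simpa using hlim

open scoped Convolution in
lemma tendsto_integral_norm_convolution_sub {n : ℕ} {E : Type*}
    [NormedAddCommGroup E] [NormedSpace ℝ E] [CompleteSpace E] {b : ℕ → ContDiffBump (0 : Eu n)}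
    (hb : Tendsto (fun k => (b k).rOut) atTop (𝓝 0)) {F : Eu n → E} (hF : Integrable F) :
    Tendsto (fun k => ∫ x, ‖((b k).normed volume ⋆[ContinuousLinearMap.lsmul ℝ ℝ, volume] F) x -
      F x‖) atTop (𝓝 0) := by
  rw [Metric.tendsto_atTop]
  intro ε hε
  obtain ⟨g, hgs, hFg, hg, hgi⟩ := hF.exists_hasCompactSupport_integral_sub_le
    (show 0 < ε / 4 by positivity)
  have hlim := tendsto_integral_norm_convolution_sub_of_continuous hb hg hgs
  obtain ⟨N, hN⟩ := eventually_atTop.1 (hlim.eventually_lt_const (show 0 < ε / 4 by positivity))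
  refine ⟨N, fun k hk => ?_⟩
  rw [Real.dist_0_eq_abs, abs_of_nonneg (integral_nonneg fun _ => norm_nonneg _)]
  set η := (b k).normed volume
  have hη : Integrable η := (b k).integrable_normed
  have hη1 := (b k).hasCompactSupport_normed (μ := volume)
  have hη2 := (b k).continuous_normed (μ := volume)
  have hsub : ∀ x, (η ⋆[ContinuousLinearMap.lsmul ℝ ℝ, volume] F) x =
      (η ⋆[ContinuousLinearMap.lsmul ℝ ℝ, volume] (F - g)) x +
      (η ⋆[ContinuousLinearMap.lsmul ℝ ℝ, volume] g) x := fun x => by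
    have h1 := hη1.convolutionExists_left (ContinuousLinearMap.lsmul ℝ ℝ : ℝ →L[ℝ] E →L[ℝ] E)
      hη2 (hF.sub hgi).locallyIntegrable x
    have h2 := hη1.convolutionExists_left (ContinuousLinearMap.lsmul ℝ ℝ : ℝ →L[ℝ] E →L[ℝ] E)
      hη2 hgi.locallyIntegrable x
    rw [← h1.distrib_add h2, sub_add_cancel]
  have hY := integral_norm_convolution_le (b k) (hF.sub hgi)
  have hi1 : Integrable fun x => ‖(η ⋆[ContinuousLinearMap.lsmul ℝ ℝ, volume] (F - g)) x‖ :=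
    (hη.integrable_convolution (ContinuousLinearMap.lsmul ℝ ℝ : ℝ →L[ℝ] E →L[ℝ] E)
      (hF.sub hgi)).norm
  have hi2 : Integrable fun x => ‖(η ⋆[ContinuousLinearMap.lsmul ℝ ℝ, volume] g) x - g x‖ :=
    ((hη.integrable_convolution (ContinuousLinearMap.lsmul ℝ ℝ : ℝ →L[ℝ] E →L[ℝ] E)
      hgi).sub hgi).norm
  have hi3 : Integrable fun x => ‖F x - g x‖ := (hF.sub hgi).norm
  calc ∫ x, ‖(η ⋆[ContinuousLinearMap.lsmul ℝ ℝ, volume] F) x - F x‖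
      ≤ ∫ x, (‖(η ⋆[ContinuousLinearMap.lsmul ℝ ℝ, volume] (F - g)) x‖ +
          ‖(η ⋆[ContinuousLinearMap.lsmul ℝ ℝ, volume] g) x - g x‖ + ‖F x - g x‖) := by
        refine integral_mono_of_nonneg (ae_of_all _ fun _ => norm_nonneg _)
          ((hi1.add hi2).add hi3) (ae_of_all _ fun x => ?_)
        simp only [hsub x]
        calc _ = ‖(η ⋆[ContinuousLinearMap.lsmul ℝ ℝ, volume] (F - g)) x +
            ((η ⋆[ContinuousLinearMap.lsmul ℝ ℝ, volume] g) x - g x) - (F x - g x)‖ := by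
              congr 1; abel
          _ ≤ _ := (norm_sub_le _ _).trans (add_le_add (norm_add_le _ _) le_rfl)
    _ = (∫ x, ‖(η ⋆[ContinuousLinearMap.lsmul ℝ ℝ, volume] (F - g)) x‖) +
          (∫ x, ‖(η ⋆[ContinuousLinearMap.lsmul ℝ ℝ, volume] g) x - g x‖) +
          ∫ x, ‖F x - g x‖ := by
        rw [← integral_add hi1 hi2, ← integral_add (by exact hi1.add hi2) hi3]
    _ < ε := by
        have := hN k hk
        simp only [Pi.sub_apply] at hY
        linarith

open scoped Convolution in
lemma gradient_normed_convolution {n : ℕ} (b : ContDiffBump (0 : Eu n)) {V : Eu n → ℝ}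
    {G : Eu n → Eu n} (hV : Integrable V)
    (hVG : ∀ ψ, IsTest univ ψ → ∫ x, V x • gradient ψ x = -∫ x, ψ x • G x) (x : Eu n) :
    gradient (b.normed volume ⋆[ContinuousLinearMap.lsmul ℝ ℝ, volume] V) x =
      (b.normed volume ⋆[ContinuousLinearMap.lsmul ℝ ℝ, volume] G) x := by
  set η := b.normed volume with hη
  have hηc : ContDiff ℝ (⊤ : ℕ∞) η := b.contDiff_normed
  have hηs : HasCompactSupport η := b.hasCompactSupport_normed
  have hηd : Differentiable ℝ η := hηc.differentiable (by simp)
  set ψ : Eu n → ℝ := fun y => η (x - y) with hψ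
  have hψt : IsTest univ ψ :=
    ⟨hηc.comp (contDiff_const.sub contDiff_id),
      hηs.comp_homeomorph (Homeomorph.subLeft x), subset_univ _⟩
  have hψd : ∀ y w, fderiv ℝ ψ y w = -fderiv ℝ η (x - y) w := fun y w => by
    have : HasFDerivAt ψ ((fderiv ℝ η (x - y)).comp (-ContinuousLinearMap.id ℝ (Eu n))) y :=
      (hηd (x - y)).hasFDerivAt.comp y ((hasFDerivAt_id y).const_sub x)
    rw [this.fderiv]
    simp
  have hfη : Continuous (fderiv ℝ η) := hηc.continuous_fderiv (by simp)
  have hd := hηs.hasFDerivAt_convolution_left (ContinuousLinearMap.lsmul ℝ ℝ : ℝ →L[ℝ] ℝ →L[ℝ] ℝ)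
    (hηc.of_le (by simp)) hV.locallyIntegrable x
  have hex := ((hηs.fderiv ℝ).convolutionExists_left
    ((ContinuousLinearMap.lsmul ℝ ℝ : ℝ →L[ℝ] ℝ →L[ℝ] ℝ).precompL (Eu n)) hfη
      hV.locallyIntegrable x).integrable_swap
  obtain ⟨B, hB⟩ := (hψt.2.1.fderiv ℝ).exists_bound_of_continuous hψt.continuous_fderiv
  have hgi : Integrable fun y => V y • gradient ψ y := by
    refine hV.smul_bdd (C := B) ?_ ?_
    · exact ((InnerProductSpace.toDual ℝ (Eu n)).symm.continuous.comp
        hψt.continuous_fderiv).aestronglyMeasurable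
    · exact ae_of_all _ fun y => by rw [norm_gradient]; exact hB y
  refine ext_inner_right ℝ fun w => ?_
  rw [inner_gradient_left, hd.fderiv, convolution_lsmul_swap, convolution_eq_swap,
    ContinuousLinearMap.integral_apply hex]
  have h1 := congrArg (fun z => ⟪w, z⟫) (hVG ψ hψt)
  simp only [inner_neg_right] at h1
  rw [← integral_inner hgi] at h1
  simp only [inner_smul_right, inner_gradient_right, hψd] at h1
  rw [real_inner_comm, ← neg_inj, ← h1, ← integral_neg]
  refine integral_congr_ae (ae_of_all _ fun y => ?_)
  simp [ContinuousLinearMap.precompL_apply, mul_comm]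

open scoped Convolution in
/-- Smooth approximation of a compactly supported bounded Sobolev function, with a prescribed
rate for the gradients. -/
lemma exists_smooth_approx {n : ℕ} {Ω S : Set (Eu n)} (hΩ : IsOpen Ω) (hS : IsCompact S)
    (hSΩ : S ⊆ Ω) {V : Eu n → ℝ} {G : Eu n → Eu n} (hVS : Function.support V ⊆ S)
    (hV : Integrable V) (hG : Integrable G) {M : ℝ} (hM : ∀ᵐ x, |V x| ≤ M)
    (hVG : ∀ ψ, IsTest univ ψ → ∫ x, V x • gradient ψ x = -∫ x, ψ x • G x) :
    ∃ f : ℕ → Eu n → ℝ, (∀ k, IsTest Ω (f k)) ∧ (∀ k x, |f k x| ≤ M) ∧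
      Tendsto (fun k => ∫ x, |f k x - V x|) atTop (𝓝 0) ∧
      ∀ k, ∫ x, ‖gradient (f k) x - G x‖ ≤ (1 / 4) ^ k := by
  obtain ⟨δ, hδ, hthick⟩ := hS.exists_cthickening_subset_open hΩ hSΩ
  have hpos : ∀ k : ℕ, 0 < δ / (k + 1) := fun k => by positivity
  set b : ℕ → ContDiffBump (0 : Eu n) := fun k =>
    ⟨δ / (k + 1) / 2, δ / (k + 1), half_pos (hpos k), half_lt_self (hpos k)⟩ with hb
  have hlim : Tendsto (fun k => (b k).rOut) atTop (𝓝 0) := by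
    have := (tendsto_const_div_atTop_nhds_zero_nat δ).comp (tendsto_add_atTop_nat 1)
    simpa [hb, Function.comp_def] using this
  set f : ℕ → Eu n → ℝ := fun k =>
    ((b k).normed volume ⋆[ContinuousLinearMap.lsmul ℝ ℝ, volume] V) with hf
  have hle : ∀ k, (b k).rOut ≤ δ := fun k =>
    div_le_self hδ.le (by linarith [(Nat.cast_nonneg k : (0 : ℝ) ≤ k)])
  have hsupp : ∀ k, Function.support (f k) ⊆ cthickening δ S := fun k => by
    refine (support_convolution_subset_swap _).trans ?_
    rw [(b k).support_normed_eq]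
    rintro _ ⟨y, hy, z, hz, rfl⟩
    refine closedBall_subset_cthickening (hVS hy) δ ?_
    rw [mem_closedBall, dist_eq_norm, add_sub_cancel_left]
    exact (mem_ball_zero_iff.1 hz).le.trans (hle k)
  have hM0 : ∀ k x, |f k x| ≤ M := fun k x => by
    have hη := (b k).integrable_normed (μ := volume)
    simp only [hf, convolution_lsmul_swap, ← Real.norm_eq_abs]
    have hi : Integrable fun t => (b k).normed volume (x - t) * M :=
      (hη.comp_sub_left x).mul_const M
    refine (norm_integral_le_of_norm_le hi ?_).trans_eq ?_
    · filter_upwards [hM] with t ht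
      rw [norm_smul, Real.norm_of_nonneg ((b k).nonneg_normed _)]
      exact mul_le_mul_of_nonneg_left ht ((b k).nonneg_normed _)
    · rw [integral_mul_const, integral_sub_left_eq_self, (b k).integral_normed, one_mul]
  have htest : ∀ k, IsTest Ω (f k) := fun k =>
    ⟨(b k).hasCompactSupport_normed.contDiff_convolution_left _ (b k).contDiff_normed
        hV.locallyIntegrable,
      HasCompactSupport.of_support_subset_isCompact hS.cthickening (hsupp k),
      (closure_minimal (hsupp k) isClosed_cthickening).trans hthick⟩
  have hgrad : Tendsto (fun k => ∫ x, ‖gradient (f k) x - G x‖) atTop (𝓝 0) := by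
    simp only [hf, gradient_normed_convolution _ hV hVG]
    exact tendsto_integral_norm_convolution_sub hlim hG
  obtain ⟨s, hs, hsk⟩ := extraction_forall_of_eventually fun k : ℕ =>
    hgrad.eventually_le_const (show (0 : ℝ) < (1 / 4) ^ k by positivity)
  exact ⟨fun k => f (s k), fun k => htest _, fun k => hM0 _,
    (tendsto_integral_norm_convolution_sub hlim hV).comp hs.tendsto_atTop, hsk⟩

lemma average_abs_sub_triangle {n : ℕ} {B : Set (Eu n)} {f g h : Eu n → ℝ}
    (hf : IntegrableOn f B) (hg : IntegrableOn g B) (hh : IntegrableOn h B) :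
    ⨍ y in B, |f y - h y| ≤ (⨍ y in B, |f y - g y|) + ⨍ y in B, |g y - h y| := by
  rw [setAverage_eq, setAverage_eq, setAverage_eq, ← smul_add]
  simp only [smul_eq_mul]
  have h1 : IntegrableOn (fun y => |f y - g y|) B := (hf.sub hg).abs
  have h2 : IntegrableOn (fun y => |g y - h y|) B := (hg.sub hh).abs
  rw [← integral_add h1 h2]
  exact mul_le_mul_of_nonneg_left
    (integral_mono (hf.sub hh).abs (h1.add h2) fun y => abs_sub_le _ _ _) (by positivity)

lemma tendsto_average_abs_sub_of_continuous {n : ℕ} {g : Eu n → ℝ} (hg : Continuous g)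
    (x : Eu n) :
    Tendsto (fun r => ⨍ y in closedBall x r, |g y - g x|) (𝓝[>] 0) (𝓝 0) := by
  rw [Metric.tendsto_nhds]
  intro ε hε
  obtain ⟨δ, hδ, h⟩ := Metric.continuous_iff.1 hg x (ε / 2) (half_pos hε)
  filter_upwards [Ioo_mem_nhdsGT hδ] with r hr
  have hpos := volumeReal_closedBall_pos x hr.1
  have h0 : 0 ≤ ⨍ y in closedBall x r, |g y - g x| := by
    rw [setAverage_eq, smul_eq_mul]
    exact mul_nonneg (by positivity) (integral_nonneg fun _ => abs_nonneg _)
  rw [Real.dist_0_eq_abs, abs_of_nonneg h0, setAverage_eq, smul_eq_mul]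
  have hle : ∫ y in closedBall x r, |g y - g x| ≤ ∫ _ in closedBall x r, ε / 2 := by
    refine setIntegral_mono_on ?_ (integrableOn_const measure_closedBall_lt_top.ne)
      measurableSet_closedBall fun y hy => (h y ((mem_closedBall.1 hy).trans_lt hr.2)).le
    exact (hg.sub continuous_const).abs.continuousOn.integrableOn_compact (isCompact_closedBall x r)
  rw [setIntegral_const, smul_eq_mul] at hle
  calc _ ≤ (volume.real (closedBall x r))⁻¹ * (volume.real (closedBall x r) * (ε / 2)) := by
        gcongr
    _ = ε / 2 := by field_simp
    _ < ε := by linarith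

lemma average_const_closedBall {n : ℕ} (x : Eu n) {r : ℝ} (hr : 0 < r) (a : ℝ) :
    ⨍ _ in closedBall x r, a = a :=
  setAverage_const (measure_closedBall_pos _ _ hr).ne' measure_closedBall_lt_top.ne a

lemma abs_le_of_forall_average_le {n : ℕ} {g : Eu n → ℝ} (hg : Continuous g) {x : Eu n}
    {R a : ℝ} (hR : 0 < R) (h : ∀ r ∈ Ioc 0 R, ⨍ y in closedBall x r, |g y| ≤ a) :
    |g x| ≤ a := by
  have hlim := (tendsto_average_abs_sub_of_continuous hg x).const_add a
  rw [add_zero] at hlim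
  refine ge_of_tendsto hlim ?_
  filter_upwards [Ioc_mem_nhdsGT hR] with r hr
  have hi : IntegrableOn g (closedBall x r) :=
    hg.continuousOn.integrableOn_compact (isCompact_closedBall x r)
  have hc : ∀ c : ℝ, IntegrableOn (fun _ : Eu n => c) (closedBall x r) := fun c =>
    integrableOn_const measure_closedBall_lt_top.ne
  have htri := average_abs_sub_triangle (hc 0) hi (hc (g x))
  simp only [zero_sub, abs_neg] at htri
  rw [average_const_closedBall x hr.1] at htri
  linarith [h r hr]

lemma exists_tendsto_average_abs_sub {n : ℕ} {f : ℕ → Eu n → ℝ} {V : Eu n → ℝ}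
    (hf : ∀ k, Continuous (f k)) (hfi : ∀ k, Integrable (f k)) (hV : Integrable V)
    (hfV : Tendsto (fun k => ∫ x, |f k x - V x|) atTop (𝓝 0)) {x : Eu n} {R : ℝ} (hR : 0 < R)
    {N : ℕ} (h : ∀ k ≥ N, ∀ r ∈ Ioc 0 R,
      ⨍ y in closedBall x r, |f (k + 1) y - f k y| ≤ (1 / 2) ^ k) :
    ∃ c, Tendsto (fun k => f k x) atTop (𝓝 c) ∧
      Tendsto (fun r => ⨍ y in closedBall x r, |V y - c|) (𝓝[>] 0) (𝓝 0) := by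
  have hstep : ∀ k ≥ N, |f (k + 1) x - f k x| ≤ (1 / 2) ^ k := fun k hk =>
    abs_le_of_forall_average_le ((hf (k + 1)).sub (hf k)) hR (h k hk)
  have htel : ∀ k ≥ N, ∀ m, |f (k + m) x - f k x| ≤ 2 * (1 / 2) ^ k - 2 * (1 / 2) ^ (k + m) := by
    intro k hk m
    induction m with
    | zero => simp
    | succ m ih =>
      have := hstep (k + m) (by omega)
      have h3 := abs_sub_le (f (k + (m + 1)) x) (f (k + m) x) (f k x)
      rw [← add_assoc] at h3 ⊢
      rw [pow_succ]
      linarith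
  have hpow : ∀ m : ℕ, (0 : ℝ) ≤ (1 / 2) ^ m := fun m => by positivity
  have hp : Tendsto (fun k : ℕ => (1 / 2 : ℝ) ^ k) atTop (𝓝 0) :=
    tendsto_pow_atTop_nhds_zero_of_lt_one (by norm_num) (by norm_num)
  have hcauchy : CauchySeq fun k => f k x := by
    refine (cauchySeq_shift N).1 (cauchySeq_of_le_geometric (1 / 2) ((1 / 2) ^ N) (by norm_num)
      fun k => ?_)
    rw [dist_comm, Real.dist_eq, ← pow_add, add_comm N k, add_right_comm]
    exact hstep (k + N) (by omega)
  obtain ⟨c, hc⟩ := cauchySeq_tendsto_of_complete hcauchy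
  refine ⟨c, hc, ?_⟩
  have hcle : ∀ k ≥ N, |f k x - c| ≤ 2 * (1 / 2) ^ k := fun k hk => by
    have hlim : Tendsto (fun m => |f k x - f (k + m) x|) atTop (𝓝 |f k x - c|) :=
      (tendsto_const_nhds.sub ((tendsto_add_atTop_iff_nat k).2 hc |>.congr fun m => by
        rw [add_comm])).abs
    refine le_of_tendsto hlim (Eventually.of_forall fun m => ?_)
    rw [abs_sub_comm]
    linarith [htel k hk m, hpow (k + m)]
  have hbound : ∀ k ≥ N, ∀ r ∈ Ioc 0 R, ⨍ y in closedBall x r, |V y - c| ≤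
      4 * (1 / 2) ^ k + ⨍ y in closedBall x r, |f k y - f k x| := by
    intro k hk r hr
    have hconst : ∀ a : ℝ, IntegrableOn (fun _ : Eu n => a) (closedBall x r) := fun a =>
      integrableOn_const measure_closedBall_lt_top.ne
    have htel' : ∀ m, ⨍ y in closedBall x r, |f (k + m) y - f k y| ≤
        2 * (1 / 2) ^ k - 2 * (1 / 2) ^ (k + m) := by
      intro m
      induction m with
      | zero => simp
      | succ m ih =>
        have h1 := h (k + m) (by omega) r hr
        have h3 := average_abs_sub_triangle (hfi (k + (m + 1))).integrableOn
          (hfi (k + m)).integrableOn (hfi k).integrableOn (B := closedBall x r)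
        rw [← add_assoc] at h3 ⊢
        rw [pow_succ]
        linarith
    have hVk : ⨍ y in closedBall x r, |V y - f k y| ≤ 2 * (1 / 2) ^ k := by
      have hlim : Tendsto (fun m => (volume.real (closedBall x r))⁻¹ *
          (∫ y, |f (k + m) y - V y|) + 2 * (1 / 2) ^ k) atTop
          (𝓝 ((volume.real (closedBall x r))⁻¹ * 0 + 2 * (1 / 2) ^ k)) :=
        ((((tendsto_add_atTop_iff_nat k).2 hfV).congr fun m => by rw [add_comm]).const_mul
          _).add_const _
      rw [mul_zero, zero_add] at hlim
      refine ge_of_tendsto hlim (Eventually.of_forall fun m => ?_)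
      have h3 := average_abs_sub_triangle hV.integrableOn (hfi (k + m)).integrableOn
        (hfi k).integrableOn (B := closedBall x r)
      have h4 : ⨍ y in closedBall x r, |V y - f (k + m) y| ≤
          (volume.real (closedBall x r))⁻¹ * ∫ y, |f (k + m) y - V y| := by
        rw [setAverage_eq, smul_eq_mul]
        simp only [abs_sub_comm (V _)]
        exact mul_le_mul_of_nonneg_left (setIntegral_le_integral ((hfi _).sub hV).abs
          (ae_of_all _ fun _ => abs_nonneg _)) (by positivity)
      linarith [htel' m, hpow (k + m)]
    have h5 := average_abs_sub_triangle hV.integrableOn (hfi k).integrableOn (hconst c)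
    have h6 := average_abs_sub_triangle (hfi k).integrableOn (hconst (f k x)) (hconst c)
    rw [average_const_closedBall x hr.1] at h6
    linarith [hcle k hk]
  rw [Metric.tendsto_nhds]
  intro ε hε
  have hp4 : Tendsto (fun k : ℕ => 4 * (1 / 2 : ℝ) ^ k) atTop (𝓝 0) := by
    simpa using hp.const_mul 4
  obtain ⟨k, hk, hkN⟩ :=
    ((hp4.eventually_lt_const (half_pos hε)).and (eventually_ge_atTop N)).exists
  filter_upwards [Ioc_mem_nhdsGT hR, (tendsto_average_abs_sub_of_continuous (hf k)
    x).eventually_lt_const (half_pos hε)] with r hr hr2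
  have h0 : 0 ≤ ⨍ y in closedBall x r, |V y - c| := by
    rw [setAverage_eq, smul_eq_mul]
    exact mul_nonneg (by positivity) (integral_nonneg fun _ => abs_nonneg _)
  rw [Real.dist_0_eq_abs, abs_of_nonneg h0]
  linarith [hbound k hkN r hr]

lemma gradient_fun_sub {n : ℕ} {f h : Eu n → ℝ} {x : Eu n} (hf : DifferentiableAt ℝ f x)
    (hh : DifferentiableAt ℝ h x) :
    gradient (fun y => f y - h y) x = gradient f x - gradient h x := by
  simp only [gradient, fderiv_fun_sub hf hh, map_sub]

lemma gradient_fun_mul {n : ℕ} {f h : Eu n → ℝ} {x : Eu n} (hf : DifferentiableAt ℝ f x)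
    (hh : DifferentiableAt ℝ h x) :
    gradient (fun y => f y * h y) x = f x • gradient h x + h x • gradient f x := by
  simp only [gradient, fderiv_fun_mul hf hh, map_add, map_smul]

lemma IsTest.differentiable {n : ℕ} {Ω : Set (Eu n)} {φ : Eu n → ℝ} (hφ : IsTest Ω φ) :
    Differentiable ℝ φ := hφ.1.differentiable (by simp)

lemma IsTest.sub {n : ℕ} {Ω : Set (Eu n)} {φ ψ : Eu n → ℝ} (hφ : IsTest Ω φ)
    (hψ : IsTest Ω ψ) : IsTest Ω fun y => φ y - ψ y :=
  ⟨hφ.1.sub hψ.1, hφ.2.1.sub hψ.2.1,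
    (tsupport_sub φ ψ).trans (union_subset hφ.2.2 hψ.2.2)⟩

lemma IsTest.mul_left {n : ℕ} {Ω Ω' : Set (Eu n)} {φ ψ : Eu n → ℝ} (hφ : IsTest Ω φ)
    (hψ : IsTest Ω' ψ) : IsTest Ω fun y => φ y * ψ y :=
  ⟨hφ.1.mul hψ.1, hφ.2.1.mul_right, (tsupport_mul_subset_left).trans hφ.2.2⟩

lemma ae_exists_tendsto_average {n : ℕ} {Ω : Set (Eu n)} (hΩ : IsOpen Ω)
    {σ : Eu n → Eu n} {C : ℝ} (hσ : Bdd Ω σ C) {μ : Measure (Eu n)} (hμ : LocFinOn Ω μ)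
    (hrep : RepNegDiv Ω σ μ 0) {K : Set (Eu n)} (hK : IsCompact K) (hKΩ : K ⊆ Ω)
    {f : ℕ → Eu n → ℝ} {V : Eu n → ℝ} {G : Eu n → Eu n} (hf : ∀ k, IsTest Ω (f k))
    (hV : Integrable V) (hG : Integrable G)
    (hfV : Tendsto (fun k => ∫ x, |f k x - V x|) atTop (𝓝 0))
    (hfG : ∀ k, ∫ x, ‖gradient (f k) x - G x‖ ≤ (1 / 4) ^ k) :
    ∀ᵐ x ∂(μ.restrict K), ∃ c, Tendsto (fun k => f k x) atTop (𝓝 c) ∧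
      Tendsto (fun r => ⨍ y in closedBall x r, |V y - c|) (𝓝[>] 0) (𝓝 0) := by
  obtain ⟨R, hR, hR1, hball⟩ := exists_forall_closedBall_subset hΩ hK hKΩ
  obtain ⟨M, hM, hweak⟩ := exists_measure_le_of_lt_average hσ hμ hrep
  set D : ℕ → Eu n → ℝ := fun k y => f (k + 1) y - f k y
  have hD : ∀ k, IsTest Ω (D k) := fun k => (hf (k + 1)).sub (hf k)
  have hDint : ∀ k, ∫ y, ‖fderiv ℝ (D k) y‖ ≤ 2 * (1 / 4) ^ k := fun k => by
    have hi := fun k => ((hf k).integrable_gradient.sub hG).norm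
    calc ∫ y, ‖fderiv ℝ (D k) y‖
        ≤ ∫ y, (‖(gradient (f (k + 1)) - G) y‖ + ‖(gradient (f k) - G) y‖) := by
          refine integral_mono (hD k).integrable_norm_fderiv ((hi (k + 1)).add (hi k)) fun y => ?_
          dsimp only
          rw [← norm_gradient, gradient_fun_sub ((hf _).differentiable y)
            ((hf _).differentiable y), ← sub_sub_sub_cancel_right _ _ (G y)]
          exact norm_sub_le _ _
      _ = _ := integral_add (hi (k + 1)) (hi k)
      _ ≤ (1 / 4) ^ (k + 1) + (1 / 4) ^ k := add_le_add (hfG (k + 1)) (hfG k)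
      _ ≤ _ := by
          have : (0 : ℝ) ≤ (1 / 4) ^ k := by positivity
          rw [pow_succ]
          linarith
  set A : ℕ → Set (Eu n) := fun k =>
    {x ∈ K | ∃ r ∈ Ioc 0 R, (1 / 2) ^ k < ⨍ y in closedBall x r, |D k y|}
  have hA : ∀ k, μ.restrict K (A k) ≤ ENNReal.ofReal (2 * M * (1 / 2) ^ k) := fun k => by
    refine (Measure.restrict_apply_le _ _).trans ((hweak (D k) K (A k) R ((1 / 2) ^ k) (hD k) hK
      hKΩ hR hR1 hball (by positivity) (fun x hx => hx.1) fun x hx => hx.2).trans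
      (ENNReal.ofReal_le_ofReal ?_))
    calc M / (1 / 2) ^ k * ∫ y, ‖fderiv ℝ (D k) y‖
        ≤ M / (1 / 2) ^ k * (2 * (1 / 4) ^ k) := by
          gcongr
          exact hDint k
      _ = 2 * M * (1 / 2) ^ k := by
          have : (1 / 4 : ℝ) ^ k = (1 / 2) ^ k * (1 / 2) ^ k := by rw [← mul_pow]; norm_num
          rw [this]
          field_simp
  have hsum : ∑' k, μ.restrict K (A k) ≠ ⊤ := by
    refine ne_top_of_le_ne_top ?_ (ENNReal.tsum_le_tsum hA)
    exact (summable_geometric_two.mul_left (2 * M)).tsum_ofReal_ne_top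
  filter_upwards [ae_eventually_notMem hsum, ae_restrict_mem hK.measurableSet] with x hx hxK
  obtain ⟨N, hN⟩ := eventually_atTop.1 hx
  refine exists_tendsto_average_abs_sub (fun k => (hf k).1.continuous)
    (fun k => (hf k).1.continuous.integrable_of_hasCompactSupport (hf k).2.1) hV hfV hR
    (N := N) fun k hk r hr => ?_
  by_contra! hlt
  exact hN k hk ⟨hxK, r, hr, hlt⟩

open scoped Manifold in
lemma exists_isTest_eventuallyEq_one {n : ℕ} {Ω K : Set (Eu n)} (hΩ : IsOpen Ω)
    (hK : IsCompact K) (hKΩ : K ⊆ Ω) :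
    ∃ χ : Eu n → ℝ, IsTest Ω χ ∧ (∀ x ∈ K, ∀ᶠ y in 𝓝 x, χ y = 1) ∧ ∀ x, |χ x| ≤ 1 := by
  obtain ⟨δ, hδ, hthick⟩ := hK.exists_cthickening_subset_open hΩ hKΩ
  obtain ⟨f, hf1, hf0, hf⟩ := exists_contMDiffMap_one_nhds_of_subset_interior (n := ⊤)
    𝓘(ℝ, Eu n) hK.isClosed ((self_subset_thickening hδ K).trans
      (thickening_subset_interior_cthickening δ K))
  have hsupp : tsupport f ⊆ cthickening δ K :=
    closure_minimal (fun x hx => by_contra fun h => hx (hf0 x h)) isClosed_cthickening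
  refine ⟨f, ⟨f.contMDiff.contDiff, ?_, hsupp.trans hthick⟩, fun x hx =>
    hf1.filter_mono (nhds_le_nhdsSet hx), fun x => abs_le.2 ⟨by linarith [(hf x).1], (hf x).2⟩⟩
  exact hK.cthickening.of_isClosed_subset (isClosed_tsupport f) hsupp

lemma gradient_eq_zero_of_notMem_tsupport {n : ℕ} {φ : Eu n → ℝ} {x : Eu n}
    (hx : x ∉ tsupport φ) : gradient φ x = 0 := by
  have : fderiv ℝ φ x = 0 := by
    by_contra h
    exact hx (support_fderiv_subset ℝ h)
  simp [gradient, this]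

lemma IsTest.integrable_smul {n : ℕ} {E : Type*} [NormedAddCommGroup E] [NormedSpace ℝ E]
    {Ω : Set (Eu n)} {φ : Eu n → ℝ} (hφ : IsTest Ω φ) {g : Eu n → E}
    (hg : LocallyIntegrableOn g Ω) :
    Integrable fun x => φ x • g x := by
  rw [← integrableOn_iff_integrable_of_support_subset (s := tsupport φ)]
  · exact (hg.integrableOn_compact_subset hφ.2.2 hφ.2.1).continuousOn_smul
      hφ.1.continuous.continuousOn hφ.2.1
  · intro x hx
    by_contra h
    exact hx (by simp [image_eq_zero_of_notMem_tsupport h])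

lemma IsTest.integrable_smul_gradient {n : ℕ} {Ω : Set (Eu n)} {φ : Eu n → ℝ}
    (hφ : IsTest Ω φ) {v : Eu n → ℝ} (hv : LocallyIntegrableOn v Ω) :
    Integrable fun x => v x • gradient φ x := by
  rw [← integrableOn_iff_integrable_of_support_subset (s := tsupport φ)]
  · exact (hv.integrableOn_compact_subset hφ.2.2 hφ.2.1).smul_continuousOn
      hφ.continuous_gradient.continuousOn hφ.2.1
  · intro x hx
    by_contra h
    exact hx (by simp [gradient_eq_zero_of_notMem_tsupport h])

/-- Leibniz rule for the weak gradient of `χ v`, extended by zero outside `Ω`. -/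
lemma HasSobGradLoc.integral_mul_smul_gradient {n : ℕ} {Ω : Set (Eu n)} {v : Eu n → ℝ}
    {g : Eu n → Eu n} (hg : HasSobGradLoc Ω v g) (hv : LocallyIntegrableOn v Ω)
    {χ ψ : Eu n → ℝ} (hχ : IsTest Ω χ) (hψ : IsTest univ ψ) :
    ∫ x, (χ x * v x) • gradient ψ x =
      -∫ x, ψ x • (χ x • g x + v x • gradient χ x) := by
  obtain ⟨D, hD⟩ := hψ.2.1.exists_bound_of_continuous hψ.1.continuous
  have hχψ := hχ.mul_left hψ
  have h := hg.2 _ hχψ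
  have hz : ∀ x ∉ Ω, χ x = 0 := fun x hx =>
    image_eq_zero_of_notMem_tsupport fun h => hx (hχ.2.2 h)
  have hgz : ∀ x ∉ Ω, gradient (fun y => χ y * ψ y) x = 0 := fun x hx =>
    gradient_eq_zero_of_notMem_tsupport fun h => hx (hχψ.2.2 h)
  rw [setIntegral_eq_integral_of_forall_compl_eq_zero fun x hx => by simp [hgz x hx],
    setIntegral_eq_integral_of_forall_compl_eq_zero fun x hx => by simp [hz x hx]] at h
  have hi1 : Integrable fun x => ψ x • (v x • gradient χ x) :=
    (hχ.integrable_smul_gradient hv).bdd_smul D hψ.1.continuous.aestronglyMeasurable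
      (ae_of_all _ hD)
  have hi2 : Integrable fun x => (χ x * ψ x) • g x := hχψ.integrable_smul hg.1
  have hi3 : Integrable fun x => v x • gradient (fun y => χ y * ψ y) x :=
    hχψ.integrable_smul_gradient hv
  have e1 : (fun x => (χ x * v x) • gradient ψ x) = fun x =>
      v x • gradient (fun y => χ y * ψ y) x - ψ x • (v x • gradient χ x) := by
    funext x
    rw [gradient_fun_mul (hχ.differentiable x) (hψ.differentiable x)]
    module
  have e2 : (fun x => ψ x • (χ x • g x + v x • gradient χ x)) = fun x =>
      (χ x * ψ x) • g x + ψ x • (v x • gradient χ x) := by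
    funext x
    module
  rw [e1, e2, integral_sub hi3 hi1, integral_add hi2 hi1, h]
  abel

lemma upperRep_eq_and_preciseRep_eq {n : ℕ} {V v : Eu n → ℝ} {x : Eu n} {c : ℝ}
    (hV : Integrable V) (hVv : V =ᶠ[𝓝 x] v)
    (h : Tendsto (fun r => ⨍ y in closedBall x r, |V y - c|) (𝓝[>] 0) (𝓝 0)) :
    upperRep v x = c ∧ preciseRep v x = c := by
  obtain ⟨r₀, hr₀, heq⟩ := Metric.nhds_basis_closedBall.eventually_iff.1 hVv
  have hint : IntegrableOn v (closedBall x r₀) :=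
    hV.integrableOn.congr_fun (fun y hy => heq hy) measurableSet_closedBall
  have hlim : Tendsto (fun r => ⨍ y in closedBall x r, |v y - c|) (𝓝[>] 0) (𝓝 0) := by
    refine h.congr' ?_
    filter_upwards [Ioc_mem_nhdsGT hr₀] with r hr
    rw [setAverage_eq, setAverage_eq,
      setIntegral_congr_fun measurableSet_closedBall fun y hy => ?_]
    have : V y = v y := heq (closedBall_subset_closedBall hr.2 hy)
    simp only [this]
  exact ⟨upperRep_eq_of_tendsto_average hr₀ hint hlim,
    preciseRep_eq_of_tendsto_average hr₀ hint hlim⟩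

lemma ae_upperRep_eq_and_preciseRep_eq {n : ℕ} {Ω K : Set (Eu n)} (hΩ : IsOpen Ω)
    (hK : IsCompact K) (hKΩ : K ⊆ Ω) {v : Eu n → ℝ} (hv : LocallyIntegrableOn v Ω) :
    ∀ᵐ x ∂(volume.restrict K), upperRep v x = v x ∧ preciseRep v x = v x := by
  obtain ⟨χ, hχ, hχ1, -⟩ := exists_isTest_eventuallyEq_one hΩ hK hKΩ
  have hV : Integrable fun x => χ x * v x := hχ.integrable_smul hv
  filter_upwards [ae_restrict_mem hK.measurableSet, ae_restrict_of_ae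
    ((Besicovitch.vitaliFamily volume).ae_tendsto_average_norm_sub hV.locallyIntegrable)]
    with x hxK hx
  have hx1 : χ x = 1 := (hχ1 x hxK).self_of_nhds
  refine upperRep_eq_and_preciseRep_eq hV ((hχ1 x hxK).mono fun y hy => by simp [hy]) ?_
  have := hx.comp (Besicovitch.tendsto_filterAt volume x)
  simpa [Function.comp_def, hx1] using this

lemma Bdd.integrableOn_inner {n : ℕ} {Ω : Set (Eu n)} {σ : Eu n → Eu n} {C : ℝ}
    (hσ : Bdd Ω σ C) {F : Eu n → Eu n} (hF : Integrable F) :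
    IntegrableOn (fun x => ⟪σ x, F x⟫) Ω := by
  refine (hF.norm.const_mul |C|).integrableOn.mono'
    (hσ.1.inner hF.aestronglyMeasurable.restrict) ?_
  filter_upwards [hσ.2] with x hx
  exact (norm_inner_le_norm _ _).trans (by gcongr; exact hx.trans (le_abs_self C))

/-- The pairing `⟨σ, Dv⟩` of a locally bounded `W^{1,1}_loc` function `v` is `σ · Dv`. -/
lemma integral_mul_inner_eq {n : ℕ} {Ω : Set (Eu n)} (hΩ : IsOpen Ω)
    {σ : Eu n → Eu n} {C : ℝ} (hσ : Bdd Ω σ C) {μ : Measure (Eu n)} (hμ : LocFinOn Ω μ)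
    (hrep : RepNegDiv Ω σ μ 0) {v : Eu n → ℝ} {g : Eu n → Eu n}
    (hv : LocallyIntegrableOn v Ω) (hg : HasSobGradLoc Ω v g) {φ χ : Eu n → ℝ}
    (hφ : IsTest Ω φ) (hχ : IsTest Ω χ) (hχ1 : ∀ x ∈ tsupport φ, ∀ᶠ y in 𝓝 x, χ y = 1)
    (hχle : ∀ x, |χ x| ≤ 1) {M : ℝ} (hM0 : 0 ≤ M)
    (hM : ∀ᵐ x ∂(volume.restrict (tsupport χ)), |v x| ≤ M) :
    AEStronglyMeasurable (preciseRep v) (μ.restrict (tsupport φ)) ∧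
    (∀ᵐ x ∂(μ.restrict (tsupport φ)), |preciseRep v x| ≤ M) ∧
    ∫ x in Ω, φ x * ⟪σ x, g x⟫ = (-∫ x in Ω, v x * ⟪σ x, gradient φ x⟫) +
      ∫ x in tsupport φ, φ x * preciseRep v x ∂μ := by
  set K := tsupport φ with hKdef
  set V : Eu n → ℝ := fun x => χ x * v x with hVdef
  set G : Eu n → Eu n := fun x => χ x • g x + v x • gradient χ x with hGdef
  have hV : Integrable V := hχ.integrable_smul hv
  have hG : Integrable G := (hχ.integrable_smul hg.1).add (hχ.integrable_smul_gradient hv)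
  have hVM : ∀ᵐ x, |V x| ≤ M := by
    filter_upwards [(ae_restrict_iff' (isClosed_tsupport χ).measurableSet).1 hM] with x hx
    by_cases hxχ : x ∈ tsupport χ
    · rw [hVdef, abs_mul]
      exact (mul_le_of_le_one_left (abs_nonneg _) (hχle x)).trans (hx hxχ)
    · simpa [hVdef, image_eq_zero_of_notMem_tsupport hxχ] using hM0
  have hVS : Function.support V ⊆ tsupport χ := fun x hx => by
    by_contra h
    exact hx (by simp [hVdef, image_eq_zero_of_notMem_tsupport h])
  obtain ⟨f, hf, hfM, hfV, hfG⟩ := exists_smooth_approx hΩ hχ.2.1 hχ.2.2 hVS hV hG hVM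
    fun ψ hψ => hg.integral_mul_smul_gradient hv hχ hψ
  have hlim : ∀ᵐ x ∂(μ.restrict K), Tendsto (fun k => f k x) atTop (𝓝 (preciseRep v x)) := by
    filter_upwards [ae_restrict_mem (isClosed_tsupport φ).measurableSet,
      ae_exists_tendsto_average hΩ hσ hμ hrep hφ.2.1 hφ.2.2 hf hV hG hfV hfG]
      with x hxK ⟨c, hc, hav⟩
    rwa [(upperRep_eq_and_preciseRep_eq hV
      ((hχ1 x hxK).mono fun y hy => by simp [hVdef, hy]) hav).2]
  refine ⟨aestronglyMeasurable_of_tendsto_ae atTop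
    (fun k => (hf k).1.continuous.aestronglyMeasurable) hlim, ?_, ?_⟩
  · filter_upwards [hlim] with x hx
    exact le_of_tendsto hx.abs (Eventually.of_forall fun k => hfM k x)
  obtain ⟨A, hA⟩ := hφ.2.1.exists_bound_of_continuous hφ.1.continuous
  obtain ⟨B, hB⟩ : ∃ B, ∀ x, ‖gradient φ x‖ ≤ B := by
    simp only [norm_gradient]
    exact (hφ.2.1.fderiv ℝ).exists_bound_of_continuous hφ.continuous_fderiv
  have hμK : IsFiniteMeasure (μ.restrict K) := ⟨by simpa using hμ.1 K hφ.2.2 hφ.2.1⟩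
  have hlimμ : Tendsto (fun k => ∫ x in K, φ x * f k x ∂μ) atTop
      (𝓝 (∫ x in K, φ x * preciseRep v x ∂μ)) := by
    refine tendsto_integral_of_dominated_convergence (fun _ => A * M)
      (fun k => (hφ.1.continuous.mul (hf k).1.continuous).aestronglyMeasurable)
      (integrable_const _) (fun k => ae_of_all _ fun x => ?_) ?_
    · rw [norm_mul]
      exact mul_le_mul (hA x) (hfM k x) (norm_nonneg _) ((norm_nonneg _).trans (hA x))
    · filter_upwards [hlim] with x hx using hx.const_mul _
  set F : Eu n → Eu n := fun x => φ x • G x + V x • gradient φ x with hFdef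
  have hφG : Integrable fun x => φ x • G x :=
    hG.bdd_smul A hφ.1.continuous.aestronglyMeasurable (ae_of_all _ hA)
  have hVφ : Integrable fun x => V x • gradient φ x :=
    hV.smul_bdd B hφ.continuous_gradient.aestronglyMeasurable (ae_of_all _ hB)
  have hF : Integrable F := hφG.add hVφ
  have hFk : ∀ k, Integrable (gradient fun y => φ y * f k y) := fun k =>
    (hφ.mul_left (hf k)).integrable_gradient
  have hgd : ∀ k, Integrable fun x => gradient (f k) x - G x := fun k =>
    (hf k).integrable_gradient.sub hG
  have hfd : ∀ k, Integrable fun x => f k x - V x := fun k =>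
    ((hf k).1.continuous.integrable_of_hasCompactSupport (hf k).2.1).sub hV
  have hdiff : ∀ k, ∫ x, ‖gradient (fun y => φ y * f k y) x - F x‖ ≤
      A * (1 / 4) ^ k + B * ∫ x, |f k x - V x| := fun k => by
    have hA0 : 0 ≤ A := (norm_nonneg _).trans (hA 0)
    calc ∫ x, ‖gradient (fun y => φ y * f k y) x - F x‖
        ≤ ∫ x, (A * ‖gradient (f k) x - G x‖ + B * |f k x - V x|) := by
          refine integral_mono ((hFk k).sub hF).norm
            (((hgd k).norm.const_mul A).add ((hfd k).abs.const_mul B)) fun x => ?_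
          have e : gradient (fun y => φ y * f k y) x - F x =
              φ x • (gradient (f k) x - G x) + (f k x - V x) • gradient φ x := by
            rw [gradient_fun_mul (hφ.differentiable x) ((hf k).differentiable x), hFdef]
            module
          simp only [e]
          refine (norm_add_le _ _).trans ?_
          rw [norm_smul, norm_smul, mul_comm B, Real.norm_eq_abs (f k x - V x)]
          gcongr
          exacts [hA x, hB x]
      _ = A * (∫ x, ‖gradient (f k) x - G x‖) + B * ∫ x, |f k x - V x| := by
          rw [integral_add ((hgd k).norm.const_mul A) ((hfd k).abs.const_mul B),
            integral_const_mul, integral_const_mul]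
      _ ≤ _ := by
          gcongr
          exact hfG k
  have hlimσ : Tendsto (fun k => ∫ x in Ω, ⟪σ x, gradient (fun y => φ y * f k y) x⟫) atTop
      (𝓝 (∫ x in Ω, ⟪σ x, F x⟫)) := by
    rw [tendsto_iff_norm_sub_tendsto_zero]
    have hbd : Tendsto (fun k => |C| * (A * (1 / 4 : ℝ) ^ k + B * ∫ x, |f k x - V x|)) atTop
        (𝓝 0) := by
      have := (((tendsto_pow_atTop_nhds_zero_of_lt_one (r := (1 / 4 : ℝ)) (by norm_num)
        (by norm_num)).const_mul A).add (hfV.const_mul B)).const_mul |C|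
      simpa using this
    refine squeeze_zero (fun k => norm_nonneg _) (fun k => ?_) hbd
    rw [← integral_sub (hσ.integrableOn_inner (hFk k)) (hσ.integrableOn_inner hF)]
    simp only [← inner_sub_right]
    exact (hσ.norm_integral_inner_le ((hFk k).sub hF)).trans (by gcongr; exact hdiff k)
  have hkey : ∀ k, ∫ x in Ω, ⟪σ x, gradient (fun y => φ y * f k y) x⟫ =
      ∫ x in K, φ x * f k x ∂μ := fun k => by
    rw [hrep _ (hφ.mul_left (hf k)), integral_zero_measure, sub_zero,
      setIntegral_eq_integral_of_forall_compl_eq_zero fun x hx => by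
        simp [image_eq_zero_of_notMem_tsupport hx]]
  have heq := tendsto_nhds_unique (hlimσ.congr hkey) hlimμ
  have e1 : ∀ x, ⟪σ x, φ x • G x⟫ = φ x * ⟪σ x, g x⟫ := fun x => by
    by_cases hx : x ∈ K
    · have h1 : χ x = 1 := (hχ1 x hx).self_of_nhds
      have h2 : gradient χ x = 0 := by
        have : fderiv ℝ χ x = 0 := by
          rw [Filter.EventuallyEq.fderiv_eq (f₁ := χ) (f := fun _ => (1 : ℝ)) (hχ1 x hx)]
          simp
        simp [gradient, this]
      simp [hGdef, h1, h2, inner_smul_right]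
    · simp [image_eq_zero_of_notMem_tsupport hx]
  have e2 : ∀ x, ⟪σ x, V x • gradient φ x⟫ = v x * ⟪σ x, gradient φ x⟫ := fun x => by
    by_cases hx : x ∈ K
    · have h1 : χ x = 1 := (hχ1 x hx).self_of_nhds
      simp [hVdef, h1, inner_smul_right]
    · simp [gradient_eq_zero_of_notMem_tsupport hx]
  have hi1 := hσ.integrableOn_inner hφG
  have hi2 := hσ.integrableOn_inner hVφ
  simp only [hFdef, inner_add_right] at heq
  rw [integral_add hi1 hi2] at heq
  simp only [e1, e2] at heq
  linarith

/-- approximation formula for the local pairing: with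
`σ ∈ L^∞(Ω,ℝⁿ)`, `Div σ ≤ 0` (`-Div σ = μ` Radon), `u ∈ BV_loc(Ω) ∩ L^∞_loc(Ω)`, and
approximations `v_ℓ ∈ W^{1,1}_loc(Ω) ∩ L^∞_loc(Ω)` (with weak gradients `g_ℓ`)
satisfying `v_0 ≥ v_ℓ ≥ u` a.e. and `v_ℓ* → u⁺` `H^{n-1}`-a.e. on `Ω`, one has
`⟨σ, Du⁺⟩(φ) = lim_ℓ ∫_Ω φ σ·Dv_ℓ dx` for every `φ ∈ C_c^∞(Ω)`. -/
theorem stmt19 {n : ℕ} (Ω : Set (Eu n)) (hΩ : IsOpen Ω)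
    (σ : Eu n → Eu n) (C : ℝ) (hσ : Bdd Ω σ C) (hdiv : DivNonpos Ω σ)
    (μ : Measure (Eu n)) (hμ : LocFinOn Ω μ) (hrep : RepNegDiv Ω σ μ 0)
    (u : Eu n → ℝ) (hu : MemBVLoc Ω u) (hub : LocBddFun Ω u)
    (v : ℕ → Eu n → ℝ) (g : ℕ → Eu n → Eu n)
    (hv : ∀ ℓ, LocallyIntegrableOn (v ℓ) Ω ∧ HasSobGradLoc Ω (v ℓ) (g ℓ) ∧
      LocBddFun Ω (v ℓ))
    (hord : ∀ ℓ, ∀ᵐ x ∂(volume.restrict Ω), u x ≤ v ℓ x ∧ v ℓ x ≤ v 0 x)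
    (happ : ∀ᵐ x ∂((hm n).restrict Ω),
      Tendsto (fun ℓ => preciseRep (v ℓ) x) atTop (𝓝 (upperRep u x))) :
    ∀ φ : Eu n → ℝ, IsTest Ω φ →
      Tendsto (fun ℓ => ∫ x in Ω, φ x * ⟪σ x, g ℓ x⟫) atTop
        (𝓝 ((- ∫ x in Ω, u x * ⟪σ x, gradient φ x⟫)
          + ∫ x, φ x * upperRep u x ∂μ)) := by
  intro φ hφ
  set K := tsupport φ
  have hKm : MeasurableSet K := (isClosed_tsupport φ).measurableSet
  obtain ⟨χ, hχ, hχ1, hχle⟩ := exists_isTest_eventuallyEq_one hΩ hφ.2.1 hφ.2.2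
  have hKχ : K ⊆ tsupport χ := fun x hx =>
    subset_tsupport χ (by simp [(hχ1 x hx).self_of_nhds])
  obtain ⟨M, hM0, hMv⟩ : ∃ M, 0 ≤ M ∧
      ∀ ℓ, ∀ᵐ x ∂(volume.restrict (tsupport χ)), |v ℓ x| ≤ M := by
    obtain ⟨a, ha⟩ := hub.2 _ hχ.2.2 hχ.2.1
    obtain ⟨b, hb⟩ := (hv 0).2.2.2 _ hχ.2.2 hχ.2.1
    refine ⟨max |a| |b|, by positivity, fun ℓ => ?_⟩
    filter_upwards [ha, hb, ae_restrict_of_ae_restrict_of_subset hχ.2.2 (hord ℓ)]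
      with x hxa hxb hx
    have ha' := hxa.trans ((le_abs_self a).trans (le_max_left |a| |b|))
    have hb' := hxb.trans ((le_abs_self b).trans (le_max_right |a| |b|))
    exact abs_le.2 ⟨(abs_le.1 ha').1.trans hx.1, hx.2.trans (abs_le.1 hb').2⟩
  have hpair := fun ℓ => integral_mul_inner_eq hΩ hσ hμ hrep (hv ℓ).1 (hv ℓ).2.1 hφ hχ hχ1
    hχle hM0 (hMv ℓ)
  obtain ⟨A, hA⟩ := hφ.2.1.exists_bound_of_continuous hφ.1.continuous
  have hnull : hm n {x | x ∈ Ω ∧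
      ¬Tendsto (fun ℓ => preciseRep (v ℓ) x) atTop (𝓝 (upperRep u x))} = 0 := by
    have := ae_iff.1 ((ae_restrict_iff' hΩ.measurableSet).1 happ)
    simpa only [Classical.not_imp] using this
  have haeμ : ∀ᵐ x ∂(μ.restrict K),
      Tendsto (fun ℓ => preciseRep (v ℓ) x) atTop (𝓝 (upperRep u x)) := by
    rw [ae_restrict_iff' hKm, ae_iff]
    refine measure_mono_null ?_
      (measure_inter_eq_zero_of_repNegDiv hΩ hσ hμ hrep hφ.2.1 hφ.2.2 hnull)
    intro x hx
    obtain ⟨hxK, hx⟩ := Classical.not_imp.1 hx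
    exact ⟨⟨hφ.2.2 hxK, hx⟩, hxK⟩
  have haevol : ∀ᵐ x ∂(volume.restrict K), Tendsto (fun ℓ => v ℓ x) atTop (𝓝 (u x)) := by
    have h0 : ∀ᵐ x ∂(volume.restrict K),
        Tendsto (fun ℓ => preciseRep (v ℓ) x) atTop (𝓝 (upperRep u x)) := by
      rw [ae_restrict_iff' hKm, ae_iff]
      refine measure_mono_null ?_ (volume_eq_zero_of_hm_eq_zero hnull)
      intro x hx
      obtain ⟨hxK, hx⟩ := Classical.not_imp.1 hx
      exact ⟨hφ.2.2 hxK, hx⟩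
    filter_upwards [h0, ae_upperRep_eq_and_preciseRep_eq hΩ hφ.2.1 hφ.2.2 hu.1,
      ae_all_iff.2 fun ℓ => ae_upperRep_eq_and_preciseRep_eq hΩ hφ.2.1 hφ.2.2 (hv ℓ).1]
      with x hx hxu hxv
    simpa only [hxu.1, (hxv _).2] using hx
  have hμK : IsFiniteMeasure (μ.restrict K) := ⟨by simpa using hμ.1 K hφ.2.2 hφ.2.1⟩
  have hlimμ : Tendsto (fun ℓ => ∫ x in K, φ x * preciseRep (v ℓ) x ∂μ) atTop
      (𝓝 (∫ x in K, φ x * upperRep u x ∂μ)) := by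
    refine tendsto_integral_of_dominated_convergence (fun _ => A * M)
      (fun ℓ => hφ.1.continuous.aestronglyMeasurable.mul (hpair ℓ).1)
      (integrable_const _) (fun ℓ => ?_) ?_
    · filter_upwards [(hpair ℓ).2.1] with x hx
      rw [norm_mul]
      exact mul_le_mul (hA x) hx (norm_nonneg _) ((norm_nonneg _).trans (hA x))
    · filter_upwards [haeμ] with x hx using hx.const_mul _
  have hinner : IntegrableOn (fun x => ⟪σ x, gradient φ x⟫) Ω :=
    hσ.integrableOn_inner hφ.integrable_gradient
  have hlimσ : Tendsto (fun ℓ => ∫ x in Ω, v ℓ x * ⟪σ x, gradient φ x⟫) atTop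
      (𝓝 (∫ x in Ω, u x * ⟪σ x, gradient φ x⟫)) := by
    have hK' : ∀ P : Eu n → Prop, (∀ᵐ x ∂(volume.restrict K), P x) →
        ∀ᵐ x ∂(volume.restrict Ω), x ∈ K → P x := fun P hP =>
      ae_restrict_of_ae ((ae_restrict_iff' hKm).1 hP)
    refine tendsto_integral_of_dominated_convergence (fun x => M * ‖⟪σ x, gradient φ x⟫‖)
      (fun ℓ => (hv ℓ).2.2.1.mul hinner.aestronglyMeasurable) (hinner.norm.const_mul M)
      (fun ℓ => ?_) ?_
    · filter_upwards [hK' _ (ae_restrict_of_ae_restrict_of_subset hKχ (hMv ℓ))] with x hx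
      by_cases hxK : x ∈ K
      · rw [norm_mul]
        gcongr
        exact hx hxK
      · simp [gradient_eq_zero_of_notMem_tsupport hxK]
    · filter_upwards [hK' _ haevol] with x hx
      by_cases hxK : x ∈ K
      · exact (hx hxK).mul_const _
      · simp [gradient_eq_zero_of_notMem_tsupport hxK]
  have hK : ∫ x, φ x * upperRep u x ∂μ = ∫ x in K, φ x * upperRep u x ∂μ :=
    (setIntegral_eq_integral_of_forall_compl_eq_zero fun x hx => by
      simp [image_eq_zero_of_notMem_tsupport hx]).symm
  rw [hK]
  exact (hlimσ.neg.add hlimμ).congr fun ℓ => (hpair ℓ).2.2.symm
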